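/- Let N₁ ⊆ N₂ be transitive models of ZFC (with the same ordinals), let ℙ ∈ N₁ be a forcing notion, and let G be a filter on ℙ that is both (N₁,ℙ)-generic and (N₂,ℙ)-generic and satisfies N₁[G] = N₂[G]. Then N₁ = N₂. -/

import Mathlib

open ZFSet

/-- A class of sets. -/
abbrev ZClass := Set ZFSet

/-- A class is transitive. -/
def ClassTransitive (N : ZClass) : Prop := ∀ x ∈ N, ∀ y : ZFSet, y ∈ x → y ∈ N

/-- A set is a (von Neumann) ordinal: transitive set of transitive sets. -/
def ZOrd (x : ZFSet) : Prop := x.IsTransitive ∧ ∀ y ∈ x, ZFSet.IsTransitive y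

/-- First-order formulas in the language of set theory (variables are natural numbers). -/
inductive Fml : Type
  | mem : ℕ → ℕ → Fml
  | eq : ℕ → ℕ → Fml
  | impl : Fml → Fml → Fml
  | not : Fml → Fml
  | all : ℕ → Fml → Fml

/-- Satisfaction of a formula in a class `N` (with `∈` the real membership),
quantifiers relativized to `N`. -/
def FmlSat (N : ZClass) : Fml → (ℕ → ZFSet) → Prop
  | .mem i j, v => v i ∈ v j
  | .eq i j, v => v i = v j
  | .impl φ ψ, v => FmlSat N φ v → FmlSat N ψ v
  | .not φ, v => ¬ FmlSat N φ v
  | .all n φ, v => ∀ x ∈ N, FmlSat N φ (Function.update v n x)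

/-- `r` (a set of Kuratowski pairs) well-orders the set `x`. -/
def WellOrders (r x : ZFSet) : Prop :=
  (∀ a ∈ x, ∀ b ∈ x, a = b ∨ ZFSet.pair a b ∈ r ∨ ZFSet.pair b a ∈ r) ∧
  (∀ y : ZFSet, y ⊆ x → y ≠ ∅ → ∃ a, a ∈ y ∧ ∀ b ∈ y, a = b ∨ ZFSet.pair a b ∈ r)

/-- `N` is a (transitive-class) model of ZFC: closure under the ZFC axioms,
with separation and replacement as first-order schemas (relativized to `N`)
and choice in the guise of the wellordering principle. -/
structure ModelsZFC (N : ZClass) : Prop where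
  empty_mem : (∅ : ZFSet) ∈ N
  omega_mem : ZFSet.omega ∈ N
  pair_mem : ∀ x ∈ N, ∀ y ∈ N, ({x, y} : ZFSet) ∈ N
  union_mem : ∀ x ∈ N, ZFSet.sUnion x ∈ N
  power_mem : ∀ x ∈ N, ZFSet.sep (fun y => y ∈ N) (ZFSet.powerset x) ∈ N
  sep_mem : ∀ (φ : Fml) (v : ℕ → ZFSet), (∀ n, v n ∈ N) → ∀ x ∈ N,
      ZFSet.sep (fun y => FmlSat N φ (Function.update v 0 y)) x ∈ N
  repl_mem : ∀ (φ : Fml) (v : ℕ → ZFSet), (∀ n, v n ∈ N) → ∀ x ∈ N,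
      ∃ z ∈ N, ∀ b : ZFSet, b ∈ z ↔
        (b ∈ N ∧ ∃ a : ZFSet, a ∈ x ∧
          FmlSat N φ (Function.update (Function.update v 0 a) 1 b) ∧
          ∀ b' ∈ N, FmlSat N φ (Function.update (Function.update v 0 a) 1 b') → b' = b)
  choice_wo : ∀ x ∈ N, ∃ r ∈ N, WellOrders r x

/-- `le` is (the graph of) a partial order on (the members of) `P`. -/
structure ZPoset (P le : ZFSet) : Prop where
  rel : ∀ z ∈ le, ∃ p, p ∈ P ∧ ∃ q, q ∈ P ∧ z = ZFSet.pair p q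
  refl : ∀ p ∈ P, ZFSet.pair p p ∈ le
  antisymm : ∀ p q : ZFSet, ZFSet.pair p q ∈ le → ZFSet.pair q p ∈ le → p = q
  trans : ∀ p q r : ZFSet, ZFSet.pair p q ∈ le → ZFSet.pair q r ∈ le → ZFSet.pair p r ∈ le

/-- `G` is a filter on the poset `(P, le)`. -/
def ZFilter (P le : ZFSet) (G : Set ZFSet) : Prop :=
  (∀ p ∈ G, p ∈ P) ∧ G.Nonempty ∧
  (∀ p ∈ G, ∀ q : ZFSet, q ∈ P → ZFSet.pair p q ∈ le → q ∈ G) ∧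
  (∀ p ∈ G, ∀ q ∈ G, ∃ r ∈ G, ZFSet.pair r p ∈ le ∧ ZFSet.pair r q ∈ le)

/-- `D` is a dense subset of the poset `(P, le)`. -/
def ZDense (P le D : ZFSet) : Prop :=
  D ⊆ P ∧ ∀ p ∈ P, ∃ q, q ∈ D ∧ ZFSet.pair q p ∈ le

/-- `G` is an `(N, P)`-generic filter: it meets every dense subset of `P` lying in `N`. -/
def ZGeneric (N : ZClass) (P le : ZFSet) (G : Set ZFSet) : Prop :=
  ZFilter P le G ∧ ∀ D ∈ N, ZDense P le D → ∃ p ∈ G, p ∈ D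

/-- The set `g` codes the (sub)class `G`. -/
def Codes (g : ZFSet) (G : Set ZFSet) : Prop := ∀ p : ZFSet, p ∈ g ↔ p ∈ G

/-- `NG` is the generic extension `N[G]`: the least transitive ZFC class model
containing `N` and (a set coding) `G`. -/
def IsGenericExt (N : ZClass) (G : Set ZFSet) (NG : ZClass) : Prop :=
  ClassTransitive NG ∧ ModelsZFC NG ∧ N ⊆ NG ∧ (∃ g ∈ NG, Codes g G) ∧
  ∀ N' : ZClass, ClassTransitive N' → ModelsZFC N' → N ⊆ N' → (∃ g ∈ N', Codes g G) → NG ⊆ N'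

/-- `f` is (the graph of) a surjection from `a` onto `b`. -/
def ZSurj (a b f : ZFSet) : Prop :=
  ZFSet.IsFunc a b f ∧ ∀ y ∈ b, ∃ x, x ∈ a ∧ ZFSet.pair x y ∈ f

universe u

/-! ### Renaming of variables -/

namespace Fml

/-- A bound for the indices of the variables of a formula. -/
def bound : Fml → ℕ
  | .mem i j => max i j
  | .eq i j => max i j
  | .impl φ ψ => max φ.bound ψ.bound
  | .not φ => φ.bound
  | .all n φ => max n φ.bound

/-- Capture-avoiding renaming of the free variables of a formula. -/
def rename : (ℕ → ℕ) → Fml → Fml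
  | f, .mem i j => .mem (f i) (f j)
  | f, .eq i j => .eq (f i) (f j)
  | f, .impl φ ψ => .impl (rename f φ) (rename f ψ)
  | f, .not φ => .not (rename f φ)
  | f, .all n φ =>
    .all ((Finset.range (φ.bound + 1)).sup f + 1)
      (rename (Function.update f n ((Finset.range (φ.bound + 1)).sup f + 1)) φ)

end Fml

theorem FmlSat.congr {N : ZClass.{u}} (φ : Fml) :
    ∀ {v w : ℕ → ZFSet.{u}}, (∀ n ≤ φ.bound, v n = w n) → (FmlSat N φ v ↔ FmlSat N φ w) := by
  induction φ with
  | mem i j =>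
    intro v w h
    simp [FmlSat, h i (le_max_left _ _), h j (le_max_right _ _)]
  | eq i j =>
    intro v w h
    simp [FmlSat, h i (le_max_left _ _), h j (le_max_right _ _)]
  | impl φ ψ ihφ ihψ =>
    intro v w h
    simp only [FmlSat]
    rw [ihφ fun n hn => h n (hn.trans (le_max_left _ _)),
      ihψ fun n hn => h n (hn.trans (le_max_right _ _))]
  | not φ ih =>
    intro v w h
    simp only [FmlSat]
    rw [ih h]
  | all m φ ih =>
    intro v w h
    simp only [FmlSat]
    refine forall₂_congr fun x _ => ih fun n hn => ?_
    by_cases hnm : n = m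
    · subst hnm; simp
    · simp [hnm, h n (hn.trans (le_max_right _ _))]

theorem FmlSat.rename_iff {N : ZClass.{u}} (φ : Fml) :
    ∀ (f : ℕ → ℕ) (v : ℕ → ZFSet.{u}),
      FmlSat N (φ.rename f) v ↔ FmlSat N φ (fun n => v (f n)) := by
  induction φ with
  | mem i j => intro f v; rfl
  | eq i j => intro f v; rfl
  | impl φ ψ ihφ ihψ => intro f v; simp only [Fml.rename, FmlSat, ihφ, ihψ]
  | not φ ih => intro f v; simp only [Fml.rename, FmlSat, ih]
  | all m φ ih =>
    intro f v
    simp only [Fml.rename, FmlSat, ih]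
    refine forall₂_congr fun x _ => FmlSat.congr φ fun n hn => ?_
    by_cases hnm : n = m
    · subst hnm; simp
    · have : f n ≤ (Finset.range (φ.bound + 1)).sup f :=
        Finset.le_sup (f := f) (Finset.mem_range.2 (Nat.lt_succ_of_le hn))
      have hne : f n ≠ (Finset.range (φ.bound + 1)).sup f + 1 := by omega
      simp [hnm, hne]

/-! ### Definability with parameters -/

/-- The tail of an assignment. -/
abbrev Env.tail (v : ℕ → ZFSet.{u}) : ℕ → ZFSet.{u} := fun n => v (n + 1)

/-- Prepend a value to an assignment. -/
def Env.cons (x : ZFSet.{u}) (v : ℕ → ZFSet.{u}) : ℕ → ZFSet.{u}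
  | 0 => x
  | n + 1 => v n

/-- A function of assignments that is a variable or a parameter from `N`. -/
def SimpleTerm (N : ZClass.{u}) (t : (ℕ → ZFSet.{u}) → ZFSet.{u}) : Prop :=
  (∃ i : ℕ, t = fun v => v i) ∨ ∃ a ∈ N, t = fun _ => a

theorem SimpleTerm.var {N : ZClass.{u}} (i : ℕ) : SimpleTerm N fun v => v i := .inl ⟨i, rfl⟩

theorem SimpleTerm.const {N : ZClass.{u}} {a : ZFSet.{u}} (ha : a ∈ N) :
    SimpleTerm N fun _ => a := .inr ⟨a, ha, rfl⟩

theorem SimpleTerm.mem {N : ZClass.{u}} {t} (ht : SimpleTerm N t) {v : ℕ → ZFSet.{u}}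
    (hv : ∀ n, v n ∈ N) : t v ∈ N := by
  rcases ht with ⟨i, rfl⟩ | ⟨a, ha, rfl⟩
  exacts [hv i, ha]

/-- A relation on assignments is definable over `N` with parameters from `N`. -/
def Dfb (N : ZClass.{u}) (R : (ℕ → ZFSet.{u}) → Prop) : Prop :=
  ∃ (φ : Fml) (h : ℕ → (ℕ → ZFSet.{u}) → ZFSet.{u}), (∀ n, SimpleTerm N (h n)) ∧
    ∀ v : ℕ → ZFSet.{u}, (∀ n, v n ∈ N) → (FmlSat N φ (fun n => h n v) ↔ R v)

/-- A function of assignments with values in `N` and definable graph. -/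
structure DfbTerm (N : ZClass.{u}) (t : (ℕ → ZFSet.{u}) → ZFSet.{u}) : Prop where
  mem : ∀ v : ℕ → ZFSet.{u}, (∀ n, v n ∈ N) → t v ∈ N
  graph : Dfb N fun v => v 0 = t (Env.tail v)

namespace Dfb

variable {N : ZClass.{u}} {R S : (ℕ → ZFSet.{u}) → Prop}

theorem congr (hR : Dfb N R) (h : ∀ v, (∀ n, v n ∈ N) → (R v ↔ S v)) : Dfb N S := by
  obtain ⟨φ, t, ht, hφ⟩ := hR
  exact ⟨φ, t, ht, fun v hv => (hφ v hv).trans (h v hv)⟩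

theorem sat (φ : Fml) : Dfb N (FmlSat N φ) :=
  ⟨φ, fun n v => v n, fun n => .var n, fun _ _ => Iff.rfl⟩

theorem reindex (hR : Dfb N R) {t : ℕ → (ℕ → ZFSet.{u}) → ZFSet.{u}}
    (ht : ∀ n, SimpleTerm N (t n)) : Dfb N fun v => R fun n => t n v := by
  obtain ⟨φ, h, hh, hφ⟩ := hR
  refine ⟨φ, fun n v => h n fun k => t k v, fun n => ?_,
    fun v hv => hφ _ fun n => (ht n).mem hv⟩
  rcases hh n with ⟨i, hi⟩ | ⟨a, ha, hi⟩
  · simpa only [hi] using ht i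
  · simpa only [hi] using SimpleTerm.const ha

protected theorem not (hR : Dfb N R) : Dfb N fun v => ¬ R v := by
  obtain ⟨φ, h, hh, hφ⟩ := hR
  exact ⟨.not φ, h, hh, fun v hv => not_congr (hφ v hv)⟩

protected theorem imp (hR : Dfb N R) (hS : Dfb N S) : Dfb N fun v => R v → S v := by
  obtain ⟨φ, h, hh, hφ⟩ := hR
  obtain ⟨ψ, k, hk, hψ⟩ := hS
  refine ⟨.impl (φ.rename (2 * ·)) (ψ.rename (2 * · + 1)),
    fun n => if n % 2 = 0 then h (n / 2) else k (n / 2), fun n => ?_, fun v hv => ?_⟩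
  · dsimp only; split_ifs
    exacts [hh _, hk _]
  · simp only [FmlSat, FmlSat.rename_iff]
    rw [← hφ v hv, ← hψ v hv]
    have h1 : ∀ n : ℕ, (2 * n) % 2 = 0 := by omega
    have h2 : ∀ n : ℕ, (2 * n) / 2 = n := by omega
    have h3 : ∀ n : ℕ, ¬ (2 * n + 1) % 2 = 0 := by omega
    have h4 : ∀ n : ℕ, (2 * n + 1) / 2 = n := by omega
    simp only [h1, h2, h3, h4, if_true, if_false]

protected theorem and (hR : Dfb N R) (hS : Dfb N S) : Dfb N fun v => R v ∧ S v :=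
  (hR.imp hS.not).not.congr fun v _ => by tauto

protected theorem or (hR : Dfb N R) (hS : Dfb N S) : Dfb N fun v => R v ∨ S v :=
  (hR.not.imp hS).congr fun v _ => by tauto

protected theorem iff (hR : Dfb N R) (hS : Dfb N S) : Dfb N fun v => R v ↔ S v :=
  ((hR.imp hS).and (hS.imp hR)).congr fun v _ => by tauto

protected theorem all {Q : ZFSet.{u} → (ℕ → ZFSet.{u}) → Prop}
    (hQ : Dfb N fun v => Q (v 0) (Env.tail v)) : Dfb N fun v => ∀ x, x ∈ N → Q x v := by
  obtain ⟨φ, h, hh, hφ⟩ := hQ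
  by_cases hne : ∃ a, a ∈ N
  swap
  · exact ⟨φ, h, hh, fun v hv => absurd ⟨v 0, hv 0⟩ hne⟩
  obtain ⟨a₀, ha₀⟩ := hne
  have key : ∀ n, ∃ (k : ℕ) (a : ZFSet.{u}), a ∈ N ∧
      ((k = 0 ∧ h n = fun v => v 0) ∨ (∃ i, k = 2 * i + 1 ∧ h n = fun v => v (i + 1)) ∨
        (k = 2 * n + 2 ∧ h n = fun _ => a)) := by
    intro n
    rcases hh n with ⟨i, hi⟩ | ⟨a, ha, hi⟩
    · cases i with
      | zero => exact ⟨0, a₀, ha₀, .inl ⟨rfl, hi⟩⟩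
      | succ i => exact ⟨2 * i + 1, a₀, ha₀, .inr (.inl ⟨i, rfl, hi⟩)⟩
    · exact ⟨2 * n + 2, a, ha, .inr (.inr ⟨rfl, hi⟩)⟩
  choose f a ha hf using key
  refine ⟨.all 0 (φ.rename f),
    fun k v => if k % 2 = 1 then v (k / 2) else a (k / 2 - 1), fun k => ?_, fun v hv => ?_⟩
  · by_cases hk : k % 2 = 1
    · simpa [hk] using SimpleTerm.var (k / 2)
    · simpa [hk] using SimpleTerm.const (ha (k / 2 - 1))
  · simp only [FmlSat, FmlSat.rename_iff]
    refine forall₂_congr fun x hx => ?_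
    have hφ' := hφ (Env.cons x v) (fun n => by cases n; exacts [hx, hv _])
    refine Iff.trans (iff_of_eq ?_) hφ'
    suffices hs : ∀ n, Function.update
        (fun k => if k % 2 = 1 then v (k / 2) else a (k / 2 - 1)) 0 x (f n)
          = h n (Env.cons x v) by simp only [hs]
    intro n
    rcases hf n with ⟨hk, hn⟩ | ⟨i, hk, hn⟩ | ⟨hk, hn⟩
    · simp [hk, hn, Env.cons]
    · have h1 : (2 * i + 1) / 2 = i := by omega
      simp [hk, hn, Env.cons, h1]
    · simp [hk, hn]

protected theorem ex {Q : ZFSet.{u} → (ℕ → ZFSet.{u}) → Prop}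
    (hQ : Dfb N fun v => Q (v 0) (Env.tail v)) : Dfb N fun v => ∃ x, x ∈ N ∧ Q x v :=
  (Dfb.all (Q := fun x v => ¬ Q x v) hQ.not).not.congr fun v _ => by push Not; rfl

theorem subst {Q : ZFSet.{u} → (ℕ → ZFSet.{u}) → Prop} {t}
    (hQ : Dfb N fun v => Q (v 0) (Env.tail v)) (ht : DfbTerm N t) :
    Dfb N fun v => Q (t v) v :=
  (Dfb.ex (Q := fun x v => x = t v ∧ Q x v) (ht.graph.and hQ)).congr fun v hv =>
    ⟨fun ⟨_, _, h, hx⟩ => h ▸ hx, fun h => ⟨_, ht.mem v hv, rfl, h⟩⟩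

end Dfb

namespace DfbTerm

variable {N : ZClass.{u}} {s t : (ℕ → ZFSet.{u}) → ZFSet.{u}}

theorem of_simple (ht : SimpleTerm N t) : DfbTerm N t where
  mem v hv := ht.mem hv
  graph := by
    refine ⟨.eq 0 1, fun n v => if n = 0 then v 0 else t (Env.tail v), fun n => ?_,
      fun v _ => Iff.rfl⟩
    by_cases hn : n = 0
    · simpa [hn] using SimpleTerm.var 0
    · rcases ht with ⟨i, rfl⟩ | ⟨a, ha, rfl⟩
      · simpa [hn] using SimpleTerm.var (i + 1)
      · simpa [hn] using SimpleTerm.const ha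

protected theorem var (i : ℕ) : DfbTerm N fun v => v i := of_simple (.var i)

protected theorem const {a : ZFSet.{u}} (ha : a ∈ N) : DfbTerm N fun _ => a :=
  of_simple (.const ha)

theorem tail (ht : DfbTerm N t) : DfbTerm N fun v => t (Env.tail v) where
  mem v hv := ht.mem _ fun n => hv _
  graph := by
    refine (ht.graph.reindex (t := fun n v => Env.cons (v 0) (fun k => v (k + 2)) n)
      fun n => ?_).congr fun v _ => Iff.rfl
    cases n
    exacts [.var 0, .var _]

end DfbTerm

namespace Dfb

variable {N : ZClass.{u}} {a b c d : (ℕ → ZFSet.{u}) → ZFSet.{u}}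

theorem app₁ {R : ZFSet.{u} → Prop} (hR : Dfb N fun v => R (v 0)) (ha : DfbTerm N a) :
    Dfb N fun v => R (a v) := hR.subst (Q := fun x _ => R x) ha

theorem app₂ {R : ZFSet.{u} → ZFSet.{u} → Prop} (hR : Dfb N fun v => R (v 0) (v 1))
    (ha : DfbTerm N a) (hb : DfbTerm N b) : Dfb N fun v => R (a v) (b v) :=
  Dfb.subst (Q := fun x v => R (a v) x)
    (Dfb.subst (Q := fun x v => R x (v 0)) hR ha.tail) hb

theorem app₃ {R : ZFSet.{u} → ZFSet.{u} → ZFSet.{u} → Prop}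
    (hR : Dfb N fun v => R (v 0) (v 1) (v 2))
    (ha : DfbTerm N a) (hb : DfbTerm N b) (hc : DfbTerm N c) :
    Dfb N fun v => R (a v) (b v) (c v) :=
  Dfb.subst (Q := fun x v => R (a v) (b v) x)
    (Dfb.subst (Q := fun x v => R (a (Env.tail v)) x (v 0))
      (Dfb.subst (Q := fun x v => R x (v 0) (v 1)) hR ha.tail.tail) hb.tail) hc

protected theorem mem (ha : DfbTerm N a) (hb : DfbTerm N b) : Dfb N fun v => a v ∈ b v :=
  app₂ (R := fun x y => x ∈ y) (Dfb.sat (.mem 0 1)) ha hb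

protected theorem eq (ha : DfbTerm N a) (hb : DfbTerm N b) : Dfb N fun v => a v = b v :=
  app₂ (R := fun x y => x = y) (Dfb.sat (.eq 0 1)) ha hb

protected theorem ball (hN : ClassTransitive N) {Q : ZFSet.{u} → (ℕ → ZFSet.{u}) → Prop}
    (ha : DfbTerm N a) (hQ : Dfb N fun v => Q (v 0) (Env.tail v)) :
    Dfb N fun v => ∀ x, x ∈ a v → Q x v :=
  (Dfb.all (Q := fun x v => x ∈ a v → Q x v) ((Dfb.mem (.var 0) ha.tail).imp hQ)).congr
    fun v hv => ⟨fun h x hx => h x (hN _ (ha.mem v hv) _ hx) hx, fun h x _ hx => h x hx⟩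

protected theorem bex (hN : ClassTransitive N) {Q : ZFSet.{u} → (ℕ → ZFSet.{u}) → Prop}
    (ha : DfbTerm N a) (hQ : Dfb N fun v => Q (v 0) (Env.tail v)) :
    Dfb N fun v => ∃ x, x ∈ a v ∧ Q x v :=
  (Dfb.ball hN (Q := fun x v => ¬ Q x v) ha hQ.not).not.congr fun v _ => by push Not; rfl

end Dfb

theorem DfbTerm.insert_singleton {N : ZClass.{u}} (hN : ClassTransitive N)
    (hp : ∀ x ∈ N, ∀ y ∈ N, ({x, y} : ZFSet) ∈ N) {a b : (ℕ → ZFSet.{u}) → ZFSet.{u}}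
    (ha : DfbTerm N a) (hb : DfbTerm N b) : DfbTerm N fun v => {a v, b v} where
  mem v hv := hp _ (ha.mem v hv) _ (hb.mem v hv)
  graph := by
    refine ((((Dfb.mem ha.tail (.var 0)).and (Dfb.mem hb.tail (.var 0))).and
      (Dfb.ball hN (Q := fun x v => x = a (Env.tail v) ∨ x = b (Env.tail v)) (.var 0)
        ((Dfb.eq (.var 0) ha.tail.tail).or (Dfb.eq (.var 0) hb.tail.tail))))).congr
        fun v _ => ?_
    constructor
    · rintro ⟨⟨h1, h2⟩, h3⟩
      ext z
      rw [ZFSet.mem_pair]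
      exact ⟨h3 z, fun h => by rcases h with rfl | rfl <;> assumption⟩
    · intro h
      rw [h]
      simp

theorem DfbTerm.pair {N : ZClass.{u}} (hN : ClassTransitive N)
    (hp : ∀ x ∈ N, ∀ y ∈ N, ({x, y} : ZFSet) ∈ N) {a b : (ℕ → ZFSet.{u}) → ZFSet.{u}}
    (ha : DfbTerm N a) (hb : DfbTerm N b) : DfbTerm N fun v => ZFSet.pair (a v) (b v) := by
  have := (DfbTerm.insert_singleton hN hp (DfbTerm.insert_singleton hN hp ha ha)
    (DfbTerm.insert_singleton hN hp ha hb))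
  simpa only [ZFSet.pair_eq_singleton, ← ZFSet.pair.eq_def] using this

/-! ### Separation and replacement for definable relations -/

theorem sep_mem_of_dfb {N : ZClass.{u}} (hN : ClassTransitive N)
    (hsep : ∀ (φ : Fml) (v : ℕ → ZFSet.{u}), (∀ n, v n ∈ N) → ∀ x ∈ N,
      ZFSet.sep (fun y => FmlSat N φ (Function.update v 0 y)) x ∈ N)
    {R : ZFSet.{u} → Prop} (hR : Dfb N fun v => R (v 0)) {x : ZFSet.{u}} (hx : x ∈ N) :
    ZFSet.sep R x ∈ N := by
  obtain ⟨φ, h, hh, hφ⟩ := hR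
  have key : ∀ n, ∃ (k : ℕ) (a : ZFSet.{u}), a ∈ N ∧
      ((k = 0 ∧ ∃ i, h n = fun v => v i) ∨ (k = n + 1 ∧ h n = fun _ => a)) := by
    intro n
    rcases hh n with hi | ⟨a, ha, hi⟩
    · exact ⟨0, x, hx, .inl ⟨rfl, hi⟩⟩
    · exact ⟨n + 1, a, ha, .inr ⟨rfl, hi⟩⟩
  choose f a ha hf using key
  have := hsep (φ.rename f) (fun n => a (n - 1)) (fun n => ha _) x hx
  convert this using 1
  ext y
  simp only [ZFSet.mem_sep, FmlSat.rename_iff]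
  refine and_congr_right fun hy => ?_
  refine (hφ (fun _ => y) fun _ => hN x hx y hy).symm.trans (iff_of_eq ?_)
  suffices hs : ∀ n, h n (fun _ => y) = Function.update (fun n => a (n - 1)) 0 y (f n) by
    simp only [hs]
  intro n
  rcases hf n with ⟨hk, i, hn⟩ | ⟨hk, hn⟩ <;> simp [hk, hn]

theorem repl_mem_of_dfb {N : ZClass.{u}} (hN : ClassTransitive N) (hZ : ModelsZFC N)
    {R : ZFSet.{u} → ZFSet.{u} → Prop} (hR : Dfb N fun v => R (v 0) (v 1))
    {x : ZFSet.{u}} (hx : x ∈ N)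
    (huniq : ∀ a ∈ x, ∀ b ∈ N, ∀ b' ∈ N, R a b → R a b' → b' = b) :
    ∃ z ∈ N, ∀ b, b ∈ z ↔ b ∈ N ∧ ∃ a ∈ x, R a b := by
  obtain ⟨φ, h, hh, hφ⟩ := hR
  have key : ∀ n, ∃ (k : ℕ) (a : ZFSet.{u}), a ∈ N ∧
      ((k = 0 ∧ h n = fun v => v 0) ∨ (k = 1 ∧ ∃ i, h n = fun v => v (i + 1)) ∨
        (k = n + 2 ∧ h n = fun _ => a)) := by
    intro n
    rcases hh n with ⟨i, hi⟩ | ⟨a, ha, hi⟩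
    · cases i with
      | zero => exact ⟨0, x, hx, .inl ⟨rfl, hi⟩⟩
      | succ i => exact ⟨1, x, hx, .inr (.inl ⟨rfl, i, hi⟩)⟩
    · exact ⟨n + 2, a, ha, .inr (.inr ⟨rfl, hi⟩)⟩
  choose f c hc hf using key
  have hsat : ∀ a ∈ x, ∀ b ∈ N, (FmlSat N (φ.rename f)
      (Function.update (Function.update (fun n => c (n - 2)) 0 a) 1 b) ↔ R a b) := by
    intro a ha b hb
    rw [FmlSat.rename_iff]
    refine Iff.trans (iff_of_eq ?_) (hφ (Env.cons a fun _ => b)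
      (fun n => by cases n; exacts [hN x hx a ha, hb]))
    suffices hs : ∀ n, Function.update (Function.update (fun n => c (n - 2)) 0 a) 1 b (f n)
        = h n (Env.cons a fun _ => b) by simp only [hs]
    intro n
    rcases hf n with ⟨hk, hn⟩ | ⟨hk, i, hn⟩ | ⟨hk, hn⟩ <;> simp [hk, hn, Env.cons]
  obtain ⟨z, hz, hzb⟩ := hZ.repl_mem (φ.rename f) (fun n => c (n - 2)) (fun n => hc _) x hx
  refine ⟨z, hz, fun b => (hzb b).trans (and_congr_right fun hb => exists_congr fun a =>
    and_congr_right fun ha => ?_)⟩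
  rw [hsat a ha b hb]
  exact ⟨fun h => h.1, fun h => ⟨h, fun b' hb' hs =>
    huniq a ha b hb b' hb' h ((hsat a ha b' hb').1 hs)⟩⟩

/-! ### Transitive models of fragments of set theory -/

/-- A transitive class satisfying pairing, union, power set and separation. -/
structure BasicModel (N : ZClass.{u}) : Prop where
  trans : ClassTransitive N
  pair_mem : ∀ x ∈ N, ∀ y ∈ N, ({x, y} : ZFSet) ∈ N
  union_mem : ∀ x ∈ N, ZFSet.sUnion x ∈ N
  power_mem : ∀ x ∈ N, ZFSet.sep (fun y => y ∈ N) (ZFSet.powerset x) ∈ N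
  sep_mem : ∀ {R : ZFSet.{u} → Prop}, Dfb N (fun v => R (v 0)) → ∀ {x}, x ∈ N → ZFSet.sep R x ∈ N

theorem ModelsZFC.basic {N : ZClass.{u}} (hZ : ModelsZFC N) (hN : ClassTransitive N) :
    BasicModel N where
  trans := hN
  pair_mem := hZ.pair_mem
  union_mem := hZ.union_mem
  power_mem := hZ.power_mem
  sep_mem hR _ hx := sep_mem_of_dfb hN hZ.sep_mem hR hx

namespace BasicModel

variable {N : ZClass.{u}} (hB : BasicModel N)

include hB

theorem singleton_mem {x : ZFSet.{u}} (hx : x ∈ N) : ({x} : ZFSet) ∈ N := by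
  simpa using hB.pair_mem x hx x hx

theorem union₂_mem {x y : ZFSet.{u}} (hx : x ∈ N) (hy : y ∈ N) : x ∪ y ∈ N :=
  hB.union_mem _ (hB.pair_mem x hx y hy)

theorem insert_mem {x y : ZFSet.{u}} (hx : x ∈ N) (hy : y ∈ N) : insert x y ∈ N := by
  have : insert x y = {x} ∪ y := by ext z; simp
  rw [this]
  exact hB.union₂_mem (hB.singleton_mem hx) hy

theorem kpair_mem {x y : ZFSet.{u}} (hx : x ∈ N) (hy : y ∈ N) : ZFSet.pair x y ∈ N :=
  hB.pair_mem _ (hB.singleton_mem hx) _ (hB.pair_mem x hx y hy)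

theorem of_kpair_mem {x y : ZFSet.{u}} (h : ZFSet.pair x y ∈ N) : x ∈ N ∧ y ∈ N := by
  have h1 : ({x, y} : ZFSet) ∈ N := hB.trans _ h _ (by simp [ZFSet.pair])
  exact ⟨hB.trans _ h1 _ (by simp), hB.trans _ h1 _ (by simp)⟩

theorem term_pair {a b : (ℕ → ZFSet.{u}) → ZFSet.{u}}
    (ha : DfbTerm N a) (hb : DfbTerm N b) : DfbTerm N fun v => ZFSet.pair (a v) (b v) :=
  DfbTerm.pair hB.trans hB.pair_mem ha hb

theorem prod_mem {a b : ZFSet.{u}} (ha : a ∈ N) (hb : b ∈ N) : ZFSet.prod a b ∈ N := by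
  have hU := hB.power_mem _ (hB.power_mem _ (hB.union₂_mem ha hb))
  convert hB.sep_mem (R := fun z => ∃ x, x ∈ a ∧ ∃ y, y ∈ b ∧ z = ZFSet.pair x y)
    (Dfb.bex hB.trans (.const ha) (Dfb.bex hB.trans (.const hb)
      (Dfb.eq (.var 2) (hB.term_pair (.var 1) (.var 0))))) hU using 1
  ext z
  simp only [ZFSet.mem_prod, ZFSet.mem_sep, ZFSet.mem_powerset]
  refine ⟨?_, fun h => h.2⟩
  rintro ⟨x, hx, y, hy, rfl⟩
  have hxN := hB.trans _ ha _ hx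
  have hyN := hB.trans _ hb _ hy
  refine ⟨⟨fun w hw => ?_, hB.kpair_mem hxN hyN⟩, x, hx, y, hy, rfl⟩
  simp only [ZFSet.mem_sep, ZFSet.mem_powerset]
  rcases (by simpa [ZFSet.pair] using hw : w = {x} ∨ w = {x, y}) with rfl | rfl
  · refine ⟨fun t ht => ?_, hB.singleton_mem hxN⟩
    simp only [ZFSet.mem_singleton] at ht
    simp [ht, hx]
  · refine ⟨fun t ht => ?_, hB.pair_mem _ hxN _ hyN⟩
    simp only [ZFSet.mem_pair] at ht
    rcases ht with rfl | rfl <;> simp [hx, hy]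

theorem dfb_subset {a b : (ℕ → ZFSet.{u}) → ZFSet.{u}}
    (ha : DfbTerm N a) (hb : DfbTerm N b) : Dfb N fun v => a v ⊆ b v :=
  (Dfb.ball hB.trans (Q := fun x v => x ∈ b v) ha (Dfb.mem (.var 0) hb.tail)).congr
    fun _ _ => Iff.rfl

theorem dfb_isTransitive : Dfb N fun v => (v 0).IsTransitive :=
  (Dfb.ball hB.trans (Q := fun x v => x ⊆ v 0) (.var 0) (hB.dfb_subset (.var 0) (.var 1))).congr
    fun _ _ => Iff.rfl

end BasicModel

section Levels

variable {N : ZClass.{u}} (hN : ClassTransitive N) (hZ : ModelsZFC N)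

include hN hZ

theorem exists_isTransitive_mem (x : ZFSet.{u}) (hx : x ∈ N) :
    ∃ t ∈ N, t.IsTransitive ∧ x ∈ t := by
  have hB := hZ.basic hN
  induction x using ZFSet.inductionOn with | _ x ih
  let R : ZFSet.{u} → ZFSet.{u} → Prop := fun y t => (t.IsTransitive ∧ y ∈ t) ∧
    ∀ t', t' ∈ N → t'.IsTransitive → y ∈ t' → t ⊆ t'
  have hR : Dfb N fun v => R (v 0) (v 1) :=
    ((hB.dfb_isTransitive.app₁ (.var 1)).and (Dfb.mem (.var 0) (.var 1))).and
      (Dfb.all (Dfb.imp (hB.dfb_isTransitive.app₁ (.var 0))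
        ((Dfb.mem (.var 1) (.var 0)).imp (hB.dfb_subset (.var 2) (.var 0)))))
  have hex : ∀ y ∈ x, ∃ t ∈ N, R y t := by
    intro y hy
    have hyN := hN x hx y hy
    obtain ⟨t, ht, htt, hyt⟩ := ih y hy hyN
    have hd := hB.sep_mem (R := fun z => ∀ t', t' ∈ N → t'.IsTransitive → y ∈ t' → z ∈ t')
      (Dfb.all (Dfb.imp (hB.dfb_isTransitive.app₁ (.var 0))
        ((Dfb.mem (.const hyN) (.var 0)).imp (Dfb.mem (.var 1) (.var 0))))) ht
    refine ⟨_, hd, ⟨fun z hz w hw => ?_, ?_⟩, fun t' ht' h1 h2 z hz => ?_⟩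
    · rw [ZFSet.mem_sep] at hz ⊢
      exact ⟨htt z hz.1 hw, fun t' ht' h1 h2 => h1 z (hz.2 t' ht' h1 h2) hw⟩
    · exact ZFSet.mem_sep.2 ⟨hyt, fun t' _ _ h => h⟩
    · exact (ZFSet.mem_sep.1 hz).2 t' ht' h1 h2
  obtain ⟨z, hz, hzb⟩ := repl_mem_of_dfb hN hZ hR hx fun a _ b hb b' hb' h h' =>
    subset_antisymm (h'.2 b hb h.1.1 h.1.2) (h.2 b' hb' h'.1.1 h'.1.2)
  refine ⟨insert x (ZFSet.sUnion z), hB.insert_mem hx (hB.union_mem _ hz), fun y hy w hw => ?_,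
    by simp⟩
  rw [ZFSet.mem_insert_iff, ZFSet.mem_sUnion] at hy ⊢
  right
  rcases hy with rfl | ⟨t, ht, hyt⟩
  · obtain ⟨t, ht, hRt⟩ := hex w hw
    exact ⟨t, (hzb t).2 ⟨ht, w, hw, hRt⟩, hRt.1.2⟩
  · obtain ⟨-, w', -, hRt⟩ := (hzb t).1 ht
    exact ⟨t, ht, hRt.1.1 y hyt hw⟩

omit hN hZ in
/-- `X` is a set of pairs whose converse simulates the membership relation. -/
def IsRankSim (N : ZClass.{u}) (X : ZFSet.{u}) : Prop :=
  ∀ a, a ∈ N → ∀ b, b ∈ N → ZFSet.pair a b ∈ X →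
    ∀ c, c ∈ a → ∃ d, d ∈ b ∧ ZFSet.pair c d ∈ X

theorem dfb_exists_isRankSim :
    Dfb N fun v => ∃ X, X ∈ N ∧ IsRankSim N X ∧ ZFSet.pair (v 0) (v 1) ∈ X := by
  have hB := hZ.basic hN
  refine Dfb.ex (Dfb.and ?_ (Dfb.mem (hB.term_pair (.var 1) (.var 2)) (.var 0)))
  exact Dfb.all (Dfb.all (Dfb.imp (Dfb.mem (hB.term_pair (.var 1) (.var 0)) (.var 2))
    (Dfb.ball hN (.var 1) (Dfb.bex hN (.var 1)
      (Dfb.mem (hB.term_pair (.var 1) (.var 0)) (.var 4))))))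

theorem dfb_rank_le : Dfb N fun v => (v 0).rank ≤ (v 1).rank := by
  have hB := hZ.basic hN
  have hd := dfb_exists_isRankSim hN hZ
  refine hd.congr fun v hv => ⟨?_, ?_⟩
  · rintro ⟨X, hX, hsim, hmem⟩
    generalize v 0 = a at *
    have ha := (hB.of_kpair_mem (hN _ hX _ hmem)).1
    have hb := (hB.of_kpair_mem (hN _ hX _ hmem)).2
    generalize v 1 = b at *
    induction a using ZFSet.inductionOn generalizing b with | _ a ih
    rw [ZFSet.rank_le_iff]
    intro c hc
    obtain ⟨d, hd, hcd⟩ := hsim a ha b hb hmem c hc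
    exact (ih c hc (hN _ ha _ hc) d hcd (hN _ hb _ hd)).trans_lt (ZFSet.rank_lt_of_mem hd)
  · obtain ⟨s, hs, hst, has⟩ := exists_isTransitive_mem hN hZ _ (hv 0)
    obtain ⟨t, ht, htt, hbt⟩ := exists_isTransitive_mem hN hZ _ (hv 1)
    generalize v 0 = a at *
    generalize v 1 = b at *
    have hEN := hB.sep_mem (R := fun z => ∃ x, x ∈ s ∧ ∃ y, y ∈ t ∧ z = ZFSet.pair x y ∧
        ∃ X, X ∈ N ∧ IsRankSim N X ∧ ZFSet.pair x y ∈ X)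
      (Dfb.bex hN (.const hs) (Dfb.bex hN (.const ht)
        (Dfb.and (Dfb.eq (.var 2) (hB.term_pair (.var 1) (.var 0)))
          (hd.app₂ (R := fun x y => ∃ X, X ∈ N ∧ IsRankSim N X ∧ ZFSet.pair x y ∈ X)
            (.var 1) (.var 0))))) (hB.prod_mem hs ht)
    set E := ZFSet.sep _ (ZFSet.prod s t)
    have hEmem : ∀ x y, ZFSet.pair x y ∈ E ↔ x ∈ s ∧ y ∈ t ∧
        ∃ X, X ∈ N ∧ IsRankSim N X ∧ ZFSet.pair x y ∈ X := by
      intro x y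
      simp only [E, ZFSet.mem_sep, ZFSet.pair_mem_prod, ZFSet.pair_inj]
      constructor
      · rintro ⟨-, x', hx, y', hy, ⟨rfl, rfl⟩, h⟩
        exact ⟨hx, hy, h⟩
      · rintro ⟨hx, hy, h⟩
        exact ⟨⟨hx, hy⟩, x, hx, y, hy, ⟨rfl, rfl⟩, h⟩
    have hEsim : IsRankSim N E := by
      intro x hx y hy hxy c hc
      obtain ⟨hxs, hyt, X, hX, hsim, hm⟩ := (hEmem x y).1 hxy
      obtain ⟨d, hd, hcd⟩ := hsim x hx y hy hm c hc
      exact ⟨d, hd, (hEmem c d).2 ⟨hst x hxs hc, htt y hyt hd, X, hX, hsim, hcd⟩⟩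
    suffices h : ZFSet.rank a ≤ ZFSet.rank b → ZFSet.pair a b ∈ E from
      fun h' => ⟨E, hEN, hEsim, h h'⟩
    clear hv
    induction a using ZFSet.inductionOn generalizing b with | _ a ih
    intro hab
    have haN := hN _ hs _ has
    have hbN := hN _ ht _ hbt
    refine (hEmem a b).2 ⟨has, hbt, insert (ZFSet.pair a b) E,
      hB.insert_mem (hB.kpair_mem haN hbN) hEN, ?_, by simp⟩
    intro x hx y hy hxy c hc
    rw [ZFSet.mem_insert_iff, ZFSet.pair_inj] at hxy
    rcases hxy with ⟨rfl, rfl⟩ | hxy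
    · obtain ⟨d, hd, hcd⟩ := ZFSet.lt_rank_iff.1 ((ZFSet.rank_lt_of_mem hc).trans_le hab)
      exact ⟨d, hd, ZFSet.mem_insert_of_mem _ (ih c hc (hst _ has hc) d (htt _ hbt hd) hcd)⟩
    · obtain ⟨d, hd, hcd⟩ := hEsim x hx y hy hxy c hc
      exact ⟨d, hd, ZFSet.mem_insert_of_mem _ hcd⟩

theorem exists_level (x : ZFSet.{u}) (hx : x ∈ N) :
    ∃ L ∈ N, ∀ y, y ∈ L ↔ y ∈ N ∧ y.rank ≤ x.rank := by
  have hB := hZ.basic hN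
  induction x using ZFSet.inductionOn with | _ x ih
  have hR : Dfb N fun v => ∀ y, y ∈ N → (y ∈ v 1 ↔ y.rank ≤ (v 0).rank) :=
    Dfb.all (Dfb.iff (Dfb.mem (.var 0) (.var 2))
      ((dfb_rank_le hN hZ).app₂ (R := fun x y => x.rank ≤ y.rank) (.var 0) (.var 1)))
  obtain ⟨z, hz, hzb⟩ := repl_mem_of_dfb (R := fun w L => ∀ y, y ∈ N → (y ∈ L ↔ y.rank ≤ w.rank))
    hN hZ hR hx fun a _ b hb b' hb' h h' => by
      ext y
      exact ⟨fun hy => (h y (hN _ hb' _ hy)).2 ((h' y (hN _ hb' _ hy)).1 hy),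
        fun hy => (h' y (hN _ hb _ hy)).2 ((h y (hN _ hb _ hy)).1 hy)⟩
  refine ⟨_, hB.power_mem _ (hB.union_mem _ hz), fun y => ?_⟩
  rw [ZFSet.mem_sep, ZFSet.mem_powerset, and_comm]
  refine and_congr_right fun hy => ?_
  rw [ZFSet.rank_le_iff]
  constructor
  · intro h c hc
    obtain ⟨L, hL, hcL⟩ := ZFSet.mem_sUnion.1 (h hc)
    obtain ⟨-, w, hw, hLw⟩ := (hzb L).1 hL
    exact ((hLw c (hN _ hy _ hc)).1 hcL).trans_lt (ZFSet.rank_lt_of_mem hw)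
  · intro h c hc
    obtain ⟨w, hw, hcw⟩ := ZFSet.lt_rank_iff.1 (h hc)
    obtain ⟨L, hL, hLw⟩ := ih w hw (hN _ hx _ hw)
    refine ZFSet.mem_sUnion.2 ⟨L, (hzb L).2 ⟨hL, w, hw, fun y hy => ?_⟩,
      (hLw c).2 ⟨hN _ hy _ hc, hcw⟩⟩
    rw [hLw y]
    exact and_iff_right hy

theorem exists_collection {R : ZFSet.{u} → ZFSet.{u} → Prop} (hR : Dfb N fun v => R (v 0) (v 1))
    {x : ZFSet.{u}} (hx : x ∈ N) :
    ∃ c ∈ N, ∀ a ∈ x, ∀ b ∈ N, R a b → ∃ b' ∈ c, R a b' := by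
  have hB := hZ.basic hN
  let F : ZFSet.{u} → ZFSet.{u} → Prop := fun a L => ∃ b, b ∈ N ∧ R a b ∧
    (∀ b', b' ∈ N → R a b' → b.rank ≤ b'.rank) ∧ ∀ y, y ∈ N → (y ∈ L ↔ y.rank ≤ b.rank)
  have hrk {a b} (ha : DfbTerm N a) (hb : DfbTerm N b) : Dfb N fun v => (a v).rank ≤ (b v).rank :=
    (dfb_rank_le hN hZ).app₂ (R := fun x y => x.rank ≤ y.rank) ha hb
  have hF : Dfb N fun v => F (v 0) (v 1) :=
    Dfb.ex (Dfb.and (hR.app₂ (.var 1) (.var 0)) (Dfb.and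
      (Dfb.all (Dfb.imp (hR.app₂ (.var 2) (.var 0)) (hrk (.var 1) (.var 0))))
      (Dfb.all (Dfb.iff (Dfb.mem (.var 0) (.var 3)) (hrk (.var 0) (.var 1))))))
  obtain ⟨z, hz, hzb⟩ := repl_mem_of_dfb hN hZ hF hx fun a _ L hL L' hL' h h' => by
    obtain ⟨b, hb, hab, hmin, h⟩ := h
    obtain ⟨b', hb', hab', hmin', h'⟩ := h'
    have hbb := le_antisymm (hmin b' hb' hab') (hmin' b hb hab)
    ext y
    exact ⟨fun hy => (h y (hN _ hL' _ hy)).2 (hbb ▸ (h' y (hN _ hL' _ hy)).1 hy),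
      fun hy => (h' y (hN _ hL _ hy)).2 (hbb ▸ (h y (hN _ hL _ hy)).1 hy)⟩
  refine ⟨_, hB.union_mem _ hz, fun a ha b hb hab => ?_⟩
  obtain ⟨o, ⟨b₀, ⟨hb₀, hab₀⟩, rfl⟩, hmin⟩ := WellFounded.has_min
    (wellFounded_lt (α := Ordinal.{u})) (ZFSet.rank '' {b | b ∈ N ∧ R a b}) ⟨_, b, ⟨hb, hab⟩, rfl⟩
  obtain ⟨L, hL, hLb⟩ := exists_level hN hZ b₀ hb₀
  refine ⟨b₀, ZFSet.mem_sUnion.2 ⟨L, (hzb L).2 ⟨hL, a, ha, b₀, hb₀, hab₀, fun b' hb' h' =>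
    not_lt.1 (hmin _ ⟨b', ⟨hb', h'⟩, rfl⟩), fun y hy => ?_⟩, (hLb b₀).2 ⟨hb₀, le_rfl⟩⟩, hab₀⟩
  rw [hLb y]
  exact and_iff_right hy

end Levels

/-! ### Names and their values -/

/-- `σ` is a child of the name `τ` with label `p`. The set `ZFSet.pair ∅ x` serves as a
canonical name for `x`. -/
def Child (P σ p τ : ZFSet.{u}) : Prop :=
  p ∈ P ∧ (ZFSet.pair σ p ∈ τ ∨ ∃ x y, y ∈ x ∧ τ = ZFSet.pair ∅ x ∧ σ = ZFSet.pair ∅ y)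

theorem Child.rank_lt {P σ p τ : ZFSet.{u}} (h : Child P σ p τ) : σ.rank < τ.rank := by
  rcases h.2 with h | ⟨x, y, hy, rfl, rfl⟩
  · exact (ZFSet.rank_lt_of_mem (y := σ) (x := {σ}) (by simp)).trans
      ((ZFSet.rank_lt_of_mem (by simp [ZFSet.pair])).trans (ZFSet.rank_lt_of_mem h))
  · have hlt := ZFSet.rank_lt_of_mem hy
    have key : ∀ z : ZFSet.{u}, (ZFSet.pair ∅ z).rank = Order.succ (Order.succ z.rank) := by
      intro z
      have h0 : (∅ : ZFSet.{u}).rank ≤ z.rank := by simp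
      rw [ZFSet.pair, ZFSet.rank_pair, ZFSet.rank_pair, ZFSet.rank_singleton,
        max_eq_right (Order.succ_le_succ h0), max_eq_right
        (Order.succ_le_succ (Order.succ_le_succ h0))]
    rw [key, key]
    exact Order.succ_lt_succ (Order.succ_lt_succ hlt)

theorem pair_notMem_pair_empty (a b x : ZFSet.{u}) : ZFSet.pair a b ∉ ZFSet.pair ∅ x := by
  intro h
  have h0 : (∅ : ZFSet.{u}) ∈ ZFSet.pair a b := by
    rw [ZFSet.pair, ZFSet.mem_pair] at h
    rcases h with h | h <;> simp [h]
  have ha : a ∈ (∅ : ZFSet.{u}) := by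
    rw [ZFSet.pair, ZFSet.mem_pair] at h0
    rcases h0 with h | h <;> simp [h]
  simp at ha

theorem child_pair_empty_iff {P σ p x : ZFSet.{u}} :
    Child P σ p (ZFSet.pair ∅ x) ↔ p ∈ P ∧ ∃ y ∈ x, σ = ZFSet.pair ∅ y := by
  refine and_congr_right fun _ => ⟨?_, ?_⟩
  · rintro (h | ⟨x', y, hy, hx, rfl⟩)
    · exact absurd h (pair_notMem_pair_empty _ _ _)
    · obtain rfl := (ZFSet.pair_inj.1 hx).2
      exact ⟨y, hy, rfl⟩
  · rintro ⟨y, hy, rfl⟩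
    exact .inr ⟨x, y, hy, rfl, rfl⟩

/-- For a name all of whose elements are ordered pairs, children are given by membership. -/
theorem child_iff_of_forall_pair {P σ p τ : ZFSet.{u}}
    (hτ : ∀ z ∈ τ, ∃ a b, z = ZFSet.pair a b) :
    Child P σ p τ ↔ p ∈ P ∧ ZFSet.pair σ p ∈ τ := by
  refine and_congr_right fun _ => ⟨?_, .inl⟩
  rintro (h | ⟨x, y, hy, rfl, rfl⟩)
  · exact h
  · obtain ⟨a, b, hab⟩ := hτ {∅} (by simp [ZFSet.pair])
    have : ({a} : ZFSet.{u}) ∈ ({∅} : ZFSet.{u}) := by rw [hab]; simp [ZFSet.pair]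
    rw [ZFSet.mem_singleton] at this
    have h2 : a ∈ (∅ : ZFSet.{u}) := by rw [← this]; simp
    simp at h2

instance small_child (P τ : ZFSet.{u}) (G : Set ZFSet.{u}) :
    Small.{u} {σ : ZFSet.{u} // ∃ p ∈ G, Child P σ p τ} := by
  have : Small.{u} {σ : ZFSet.{u} // σ ∈ ZFSet.vonNeumann τ.rank} :=
    ZFSet.small_coe (ZFSet.vonNeumann τ.rank)
  refine small_of_injective (β := {σ : ZFSet.{u} // σ ∈ ZFSet.vonNeumann τ.rank})
    (f := fun σ => ⟨σ.1, ?_⟩) fun a b h => Subtype.ext (congrArg (fun z => z.1) h)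
  obtain ⟨p, -, hp⟩ := σ.2
  exact ZFSet.mem_vonNeumann.2 hp.rank_lt

/-- The value of the name `τ` given by the filter `G`. -/
noncomputable def nameVal (P : ZFSet.{u}) (G : Set ZFSet.{u}) (τ : ZFSet.{u}) : ZFSet.{u} :=
  ZFSet.range fun σ : {σ : ZFSet.{u} // ∃ p ∈ G, Child P σ p τ} => nameVal P G σ.1
termination_by τ.rank
decreasing_by
  obtain ⟨p, -, hp⟩ := σ.2
  exact hp.rank_lt

theorem mem_nameVal {P τ y : ZFSet.{u}} {G : Set ZFSet.{u}} :
    y ∈ nameVal P G τ ↔ ∃ σ, ∃ p ∈ G, Child P σ p τ ∧ nameVal P G σ = y := by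
  rw [nameVal, ZFSet.mem_range]
  constructor
  · rintro ⟨⟨σ, p, hp, hc⟩, rfl⟩
    exact ⟨σ, p, hp, hc, rfl⟩
  · rintro ⟨σ, p, hp, hc, rfl⟩
    exact ⟨⟨σ, p, hp, hc⟩, rfl⟩

theorem rank_nameVal_le (P : ZFSet.{u}) (G : Set ZFSet.{u}) (τ : ZFSet.{u}) :
    (nameVal P G τ).rank ≤ τ.rank := by
  induction h : τ.rank using WellFoundedLT.induction generalizing τ with | _ o ih
  subst h
  rw [ZFSet.rank_le_iff]
  intro y hy
  obtain ⟨σ, p, -, hc, rfl⟩ := mem_nameVal.1 hy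
  exact (ih _ hc.rank_lt σ rfl).trans_lt hc.rank_lt

theorem nameVal_pair_empty {P : ZFSet.{u}} {G : Set ZFSet.{u}} (hG : ∀ p ∈ G, p ∈ P)
    (hne : G.Nonempty) (x : ZFSet.{u}) : nameVal P G (ZFSet.pair ∅ x) = x := by
  induction x using ZFSet.inductionOn with | _ x ih
  ext y
  rw [mem_nameVal]
  constructor
  · rintro ⟨σ, p, -, hc, rfl⟩
    obtain ⟨-, z, hz, rfl⟩ := child_pair_empty_iff.1 hc
    rwa [ih z hz]
  · intro hy
    obtain ⟨p, hp⟩ := hne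
    exact ⟨_, p, hp, child_pair_empty_iff.2 ⟨hG p hp, y, hy, rfl⟩, ih y hy⟩

/-- The class of values of names in `N`. -/
def NameExt (N : ZClass.{u}) (P : ZFSet.{u}) (G : Set ZFSet.{u}) : ZClass.{u} :=
  {x | ∃ τ ∈ N, nameVal P G τ = x}

/-! ### The forcing relation -/

/-- Some condition below `q` lies below the label of a child `ρ` of `τ` with `E q' ρ`. -/
def Meets (N : ZClass.{u}) (P le : ZFSet.{u}) (E : ZFSet.{u} → ZFSet.{u} → Prop)
    (q τ : ZFSet.{u}) : Prop :=
  ∃ q', q' ∈ P ∧ ZFSet.pair q' q ∈ le ∧ ∃ ρ, ρ ∈ N ∧ ∃ s, s ∈ P ∧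
    Child P ρ s τ ∧ ZFSet.pair q' s ∈ le ∧ E q' ρ

theorem Meets.imp {N : ZClass.{u}} {P le : ZFSet.{u}} {E E' : ZFSet.{u} → ZFSet.{u} → Prop}
    {q τ : ZFSet.{u}} (h : Meets N P le E q τ)
    (hE : ∀ q' ∈ P, ∀ ρ ∈ N, ∀ s, Child P ρ s τ → E q' ρ → E' q' ρ) : Meets N P le E' q τ := by
  obtain ⟨q', hq', hle, ρ, hρ, s, hs, hc, hls, h⟩ := h
  exact ⟨q', hq', hle, ρ, hρ, s, hs, hc, hls, hE q' hq' ρ hρ s hc h⟩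

/-- Inclusion of `σ` in `τ` is forced by `p`, relative to a forced equality relation `E`. -/
def ForcesSub (N : ZClass.{u}) (P le : ZFSet.{u})
    (E : ZFSet.{u} → ZFSet.{u} → ZFSet.{u} → Prop) (p σ τ : ZFSet.{u}) : Prop :=
  ∀ π, π ∈ N → ∀ r, r ∈ P → Child P π r σ → ∀ q, q ∈ P → ZFSet.pair q p ∈ le →
    ZFSet.pair q r ∈ le → Meets N P le (fun q' ρ => E q' π ρ) q τ

/-- `X` is a forced bisimulation between names. -/
def ForcedBisim (N : ZClass.{u}) (P le X : ZFSet.{u}) : Prop :=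
  ∀ p, p ∈ P → ∀ σ, σ ∈ N → ∀ τ, τ ∈ N → ZFSet.pair p (ZFSet.pair σ τ) ∈ X →
    ForcesSub N P le (fun q a b => ZFSet.pair q (ZFSet.pair a b) ∈ X) p σ τ ∧
    ForcesSub N P le (fun q a b => ZFSet.pair q (ZFSet.pair b a) ∈ X) p τ σ

/-- The forcing relation for equality. -/
def ForcesEq (N : ZClass.{u}) (P le p σ τ : ZFSet.{u}) : Prop :=
  ∃ X, X ∈ N ∧ ForcedBisim N P le X ∧ ZFSet.pair p (ZFSet.pair σ τ) ∈ X

/-- The forcing relation for membership. -/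
def ForcesMem (N : ZClass.{u}) (P le p σ τ : ZFSet.{u}) : Prop :=
  ∀ q, q ∈ P → ZFSet.pair q p ∈ le → Meets N P le (fun q' ρ => ForcesEq N P le q' σ ρ) q τ

/-- The forcing relation. -/
def Forces (N : ZClass.{u}) (P le : ZFSet.{u}) : Fml → ZFSet.{u} → (ℕ → ZFSet.{u}) → Prop
  | .mem i j, p, v => ForcesMem N P le p (v i) (v j)
  | .eq i j, p, v => ForcesEq N P le p (v i) (v j)
  | .impl φ ψ, p, v =>
    ∀ q, q ∈ P → ZFSet.pair q p ∈ le → Forces N P le φ q v → Forces N P le ψ q v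
  | .not φ, p, v => ∀ q, q ∈ P → ZFSet.pair q p ∈ le → ¬ Forces N P le φ q v
  | .all n φ, p, v => ∀ τ, τ ∈ N → Forces N P le φ p (Function.update v n τ)

/-- A forcing notion in a transitive model of ZFC. -/
structure ForcingNotion (N : ZClass.{u}) (P le : ZFSet.{u}) : Prop where
  trans : ClassTransitive N
  zfc : ModelsZFC N
  cond_mem : P ∈ N
  le_mem : le ∈ N
  poset : ZPoset P le

namespace ForcingNotion

variable {N : ZClass.{u}} {P le : ZFSet.{u}} (hF : ForcingNotion N P le)

include hF

theorem basic : BasicModel N := hF.zfc.basic hF.trans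

theorem child_mem {σ p τ : ZFSet.{u}} (h : Child P σ p τ) (hτ : τ ∈ N) : σ ∈ N := by
  rcases h.2 with h | ⟨x, y, hy, rfl, rfl⟩
  · exact (hF.basic.of_kpair_mem (hF.trans _ hτ _ h)).1
  · exact hF.basic.kpair_mem hF.zfc.empty_mem (hF.trans _ (hF.basic.of_kpair_mem hτ).2 _ hy)

theorem dfb_child {a b c : (ℕ → ZFSet.{u}) → ZFSet.{u}} (ha : DfbTerm N a) (hb : DfbTerm N b)
    (hc : DfbTerm N c) : Dfb N fun v => Child P (a v) (b v) (c v) := by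
  have h : Dfb N fun v => v 1 ∈ P ∧ (ZFSet.pair (v 0) (v 1) ∈ v 2 ∨
      ∃ x, x ∈ N ∧ ∃ y, y ∈ N ∧ y ∈ x ∧ v 2 = ZFSet.pair ∅ x ∧ v 0 = ZFSet.pair ∅ y) :=
    (Dfb.mem (.var 1) (.const hF.cond_mem)).and
      ((Dfb.mem (hF.basic.term_pair (.var 0) (.var 1)) (.var 2)).or
      (Dfb.ex (Dfb.ex ((Dfb.mem (.var 0) (.var 1)).and
        ((Dfb.eq (.var 4) (hF.basic.term_pair (.const hF.zfc.empty_mem) (.var 1))).and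
          (Dfb.eq (.var 2) (hF.basic.term_pair (.const hF.zfc.empty_mem) (.var 0))))))))
  refine (h.congr fun v hv => ?_ : Dfb N fun v => Child P (v 0) (v 1) (v 2)).app₃ ha hb hc
  refine and_congr_right fun _ => or_congr_right ⟨?_, ?_⟩
  · rintro ⟨x, -, y, -, h⟩
    exact ⟨x, y, h⟩
  · rintro ⟨x, y, hy, hx, hy'⟩
    exact ⟨x, (hF.basic.of_kpair_mem (hx ▸ hv 2)).2, y,
      (hF.basic.of_kpair_mem (hy' ▸ hv 0)).2, hy, hx, hy'⟩

theorem dfb_le {a b : (ℕ → ZFSet.{u}) → ZFSet.{u}} (ha : DfbTerm N a) (hb : DfbTerm N b) :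
    Dfb N fun v => ZFSet.pair (a v) (b v) ∈ le :=
  Dfb.mem (hF.basic.term_pair ha hb) (.const hF.le_mem)

theorem dfb_forcesEq {a b c : (ℕ → ZFSet.{u}) → ZFSet.{u}} (ha : DfbTerm N a) (hb : DfbTerm N b)
    (hc : DfbTerm N c) : Dfb N fun v => ForcesEq N P le (a v) (b v) (c v) := by
  refine Dfb.app₃ (R := ForcesEq N P le) ?_ ha hb hc
  unfold ForcesEq ForcedBisim ForcesSub Meets
  have hP := hF.cond_mem
  repeat' first
    | exact DfbTerm.var _
    | exact DfbTerm.const hP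
    | apply hF.dfb_child
    | apply hF.dfb_le
    | apply hF.basic.term_pair
    | apply Dfb.and
    | apply Dfb.all
    | apply Dfb.ex
    | apply Dfb.ball hF.trans
    | apply Dfb.bex hF.trans
    | apply Dfb.imp
    | apply Dfb.mem

theorem dfb_forcesMem {a b c : (ℕ → ZFSet.{u}) → ZFSet.{u}} (ha : DfbTerm N a) (hb : DfbTerm N b)
    (hc : DfbTerm N c) : Dfb N fun v => ForcesMem N P le (a v) (b v) (c v) := by
  refine Dfb.app₃ (R := ForcesMem N P le) ?_ ha hb hc
  unfold ForcesMem Meets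
  have hP := hF.cond_mem
  repeat' first
    | exact DfbTerm.var _
    | exact DfbTerm.const hP
    | apply hF.dfb_child
    | apply hF.dfb_le
    | apply hF.dfb_forcesEq
    | apply Dfb.and
    | apply Dfb.ex
    | apply Dfb.ball hF.trans
    | apply Dfb.bex hF.trans
    | apply Dfb.imp

theorem dfb_forces (φ : Fml) : Dfb N fun v => Forces N P le φ (v 0) (Env.tail v) := by
  have hq (φ : Fml) (ih : Dfb N fun v => Forces N P le φ (v 0) (Env.tail v)) :
      Dfb N fun v => Forces N P le φ (v 0) (Env.tail (Env.tail v)) := by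
    refine (ih.reindex (t := fun n v => Env.cons (v 0) (fun k => v (k + 2)) n)
      fun n => ?_).congr fun v _ => Iff.rfl
    cases n
    exacts [.var 0, .var _]
  induction φ with
  | mem i j => exact hF.dfb_forcesMem (.var _) (.var _) (.var _)
  | eq i j => exact hF.dfb_forcesEq (.var _) (.var _) (.var _)
  | impl φ ψ ihφ ihψ =>
    exact Dfb.ball hF.trans (.const hF.cond_mem) (Dfb.imp (hF.dfb_le (.var 0) (.var 1))
      ((hq φ ihφ).imp (hq ψ ihψ)))
  | not φ ih =>
    exact Dfb.ball hF.trans (.const hF.cond_mem) (Dfb.imp (hF.dfb_le (.var 0) (.var 1))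
      (hq φ ih).not)
  | all m φ ih =>
    refine Dfb.all ?_
    refine (ih.reindex (t := fun n v =>
      Env.cons (v 1) (Function.update (fun k => v (k + 2)) m (v 0)) n)
      fun n => ?_).congr fun v _ => Iff.rfl
    cases n with
    | zero => exact .var 1
    | succ n =>
      by_cases hn : n = m
      · subst hn
        simpa [Env.cons] using SimpleTerm.var 0
      · simpa [Env.cons, hn] using SimpleTerm.var (n + 2)

/-! ### Basic properties of the forcing relation -/

theorem le_refl {p : ZFSet.{u}} (hp : p ∈ P) : ZFSet.pair p p ∈ le := hF.poset.refl p hp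

theorem le_trans {p q r : ZFSet.{u}} (h : ZFSet.pair p q ∈ le) (h' : ZFSet.pair q r ∈ le) :
    ZFSet.pair p r ∈ le := hF.poset.trans p q r h h'

omit hF in
theorem forcesSub_of_forcesEq {p σ τ : ZFSet.{u}} (hp : p ∈ P) (hσ : σ ∈ N) (hτ : τ ∈ N)
    (h : ForcesEq N P le p σ τ) : ForcesSub N P le (ForcesEq N P le) p σ τ ∧
      ForcesSub N P le (fun q a b => ForcesEq N P le q b a) p τ σ := by
  obtain ⟨X, hX, hb, hm⟩ := h
  obtain ⟨h1, h2⟩ := hb p hp σ hσ τ hτ hm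
  exact ⟨fun π hπ r hr hc q hq hqp hqr => (h1 π hπ r hr hc q hq hqp hqr).imp
      fun _ _ _ _ _ _ h => ⟨X, hX, hb, h⟩,
    fun π hπ r hr hc q hq hqp hqr => (h2 π hπ r hr hc q hq hqp hqr).imp
      fun _ _ _ _ _ _ h => ⟨X, hX, hb, h⟩⟩

theorem forcesEq_of_forcesSub {p σ τ : ZFSet.{u}} (hp : p ∈ P) (hσ : σ ∈ N) (hτ : τ ∈ N)
    (h1 : ForcesSub N P le (ForcesEq N P le) p σ τ)
    (h2 : ForcesSub N P le (fun q a b => ForcesEq N P le q b a) p τ σ) :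
    ForcesEq N P le p σ τ := by
  have hB := hF.basic
  obtain ⟨s, hs, hsm⟩ := exists_level hF.trans hF.zfc σ hσ
  obtain ⟨t, ht, htm⟩ := exists_level hF.trans hF.zfc τ hτ
  have hsc : ∀ {π r a}, a ∈ s → Child P π r a → π ∈ s := fun ha hc =>
    (hsm _).2 ⟨hF.child_mem hc ((hsm _).1 ha).1, hc.rank_lt.le.trans ((hsm _).1 ha).2⟩
  have htc : ∀ {π r a}, a ∈ t → Child P π r a → π ∈ t := fun ha hc =>
    (htm _).2 ⟨hF.child_mem hc ((htm _).1 ha).1, hc.rank_lt.le.trans ((htm _).1 ha).2⟩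
  have hEN := hB.sep_mem (R := fun z => ∃ q, q ∈ P ∧ ∃ a, a ∈ s ∧ ∃ b, b ∈ t ∧
      z = ZFSet.pair q (ZFSet.pair a b) ∧ ForcesEq N P le q a b)
    (Dfb.bex hF.trans (.const hF.cond_mem) (Dfb.bex hF.trans (.const hs)
      (Dfb.bex hF.trans (.const ht) (Dfb.and
        (Dfb.eq (.var 3) (hB.term_pair (.var 2) (hB.term_pair (.var 1) (.var 0))))
        (hF.dfb_forcesEq (.var 2) (.var 1) (.var 0))))))
    (hB.prod_mem hF.cond_mem (hB.prod_mem hs ht))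
  set E := ZFSet.sep _ (ZFSet.prod P (ZFSet.prod s t))
  have hEm : ∀ q a b, ZFSet.pair q (ZFSet.pair a b) ∈ E ↔
      q ∈ P ∧ a ∈ s ∧ b ∈ t ∧ ForcesEq N P le q a b := by
    intro q a b
    simp only [E, ZFSet.mem_sep, ZFSet.pair_mem_prod, ZFSet.pair_inj]
    constructor
    · rintro ⟨-, _, hq, _, ha, _, hb, ⟨rfl, rfl, rfl⟩, h⟩
      exact ⟨hq, ha, hb, h⟩
    · rintro ⟨hq, ha, hb, h⟩
      exact ⟨⟨hq, ha, hb⟩, q, hq, a, ha, b, hb, ⟨rfl, rfl, rfl⟩, h⟩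
  have hlift : ∀ q a b, a ∈ s → b ∈ t → ForcesSub N P le (ForcesEq N P le) q a b →
      ForcesSub N P le (fun q b' a' => ForcesEq N P le q a' b') q b a →
      ForcesSub N P le (fun q a' b' => ZFSet.pair q (ZFSet.pair a' b') ∈
        insert (ZFSet.pair p (ZFSet.pair σ τ)) E) q a b ∧
      ForcesSub N P le (fun q b' a' => ZFSet.pair q (ZFSet.pair a' b') ∈
        insert (ZFSet.pair p (ZFSet.pair σ τ)) E) q b a := by
    intro q a b ha hb h1 h2
    constructor
    · intro π hπ r hr hc q₁ hq₁ hle hle'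
      exact (h1 π hπ r hr hc q₁ hq₁ hle hle').imp fun q' hq' ρ hρ s hc' h =>
        ZFSet.mem_insert_iff.2 (.inr ((hEm ..).2 ⟨hq', hsc ha hc, htc hb hc', h⟩))
    · intro π hπ r hr hc q₁ hq₁ hle hle'
      exact (h2 π hπ r hr hc q₁ hq₁ hle hle').imp fun q' hq' ρ hρ s hc' h =>
        ZFSet.mem_insert_iff.2 (.inr ((hEm ..).2 ⟨hq', hsc ha hc', htc hb hc, h⟩))
  refine ⟨insert (ZFSet.pair p (ZFSet.pair σ τ)) E, hB.insert_mem (hB.kpair_mem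
    (hF.trans _ hF.cond_mem _ hp) (hB.kpair_mem hσ hτ)) hEN, ?_, by simp⟩
  intro q hq a ha b hb h
  rcases ZFSet.mem_insert_iff.1 h with h | h
  · simp only [ZFSet.pair_inj] at h
    obtain ⟨rfl, rfl, rfl⟩ := h
    exact hlift q a b ((hsm _).2 ⟨ha, le_rfl⟩) ((htm _).2 ⟨hb, le_rfl⟩) h1 h2
  · obtain ⟨-, ha', hb', h⟩ := (hEm ..).1 h
    obtain ⟨h1, h2⟩ := forcesSub_of_forcesEq hq ha hb h
    exact hlift q a b ha' hb' h1 h2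

end ForcingNotion

namespace ForcingNotion

variable {N : ZClass.{u}} {P le : ZFSet.{u}} (hF : ForcingNotion N P le)

include hF

theorem meets_mono {E : ZFSet.{u} → ZFSet.{u} → Prop} {p q τ : ZFSet.{u}}
    (h : Meets N P le E q τ) (hle : ZFSet.pair q p ∈ le) : Meets N P le E p τ := by
  obtain ⟨q', hq', hle', h⟩ := h
  exact ⟨q', hq', hF.le_trans hle' hle, h⟩

theorem forcesEq_mono {p q σ τ : ZFSet.{u}} (hp : p ∈ P) (hq : q ∈ P) (hσ : σ ∈ N) (hτ : τ ∈ N)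
    (h : ForcesEq N P le p σ τ) (hle : ZFSet.pair q p ∈ le) : ForcesEq N P le q σ τ := by
  obtain ⟨h1, h2⟩ := forcesSub_of_forcesEq hp hσ hτ h
  exact hF.forcesEq_of_forcesSub hq hσ hτ
    (fun π hπ r hr hc q' hq' hle' => h1 π hπ r hr hc q' hq' (hF.le_trans hle' hle))
    (fun π hπ r hr hc q' hq' hle' => h2 π hπ r hr hc q' hq' (hF.le_trans hle' hle))

theorem forcesEq_of_dense {p σ τ : ZFSet.{u}} (hp : p ∈ P) (hσ : σ ∈ N) (hτ : τ ∈ N)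
    (h : ∀ q ∈ P, ZFSet.pair q p ∈ le → ∃ r ∈ P, ZFSet.pair r q ∈ le ∧ ForcesEq N P le r σ τ) :
    ForcesEq N P le p σ τ := by
  refine hF.forcesEq_of_forcesSub hp hσ hτ ?_ ?_ <;>
  · intro π hπ r hr hc q hq hle hle'
    obtain ⟨q', hq', hl, h'⟩ := h q hq hle
    obtain ⟨h1, h2⟩ := forcesSub_of_forcesEq hq' hσ hτ h'
    refine hF.meets_mono (q := q') ?_ hl
    first
      | exact h1 π hπ r hr hc q' hq' (hF.le_refl hq') (hF.le_trans hl hle')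
      | exact h2 π hπ r hr hc q' hq' (hF.le_refl hq') (hF.le_trans hl hle')

theorem forcesMem_mono {p q σ τ : ZFSet.{u}} (h : ForcesMem N P le p σ τ)
    (hle : ZFSet.pair q p ∈ le) : ForcesMem N P le q σ τ :=
  fun q' hq' hle' => h q' hq' (hF.le_trans hle' hle)

theorem forcesMem_of_dense {p σ τ : ZFSet.{u}}
    (h : ∀ q ∈ P, ZFSet.pair q p ∈ le → ∃ r ∈ P, ZFSet.pair r q ∈ le ∧ ForcesMem N P le r σ τ) :
    ForcesMem N P le p σ τ := by
  intro q hq hle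
  obtain ⟨r, hr, hl, h'⟩ := h q hq hle
  exact hF.meets_mono (h' r hr (hF.le_refl hr)) hl

omit hF in
theorem update_mem {v : ℕ → ZFSet.{u}} (hv : ∀ n, v n ∈ N) (m : ℕ) {x : ZFSet.{u}} (hx : x ∈ N) :
    ∀ n, Function.update v m x n ∈ N := by
  intro n
  by_cases h : n = m
  · subst h; simpa using hx
  · simpa [h] using hv n

theorem forces_mono (φ : Fml) {p q : ZFSet.{u}} (hp : p ∈ P) (hq : q ∈ P)
    {v : ℕ → ZFSet.{u}} (hv : ∀ n, v n ∈ N) (h : Forces N P le φ p v)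
    (hle : ZFSet.pair q p ∈ le) : Forces N P le φ q v := by
  induction φ generalizing v with
  | mem i j => exact hF.forcesMem_mono h hle
  | eq i j => exact hF.forcesEq_mono hp hq (hv i) (hv j) h hle
  | impl φ ψ => exact fun r hr hl => h r hr (hF.le_trans hl hle)
  | not φ => exact fun r hr hl => h r hr (hF.le_trans hl hle)
  | all n φ ih => exact fun τ hτ => ih (update_mem hv n hτ) (h τ hτ)

theorem forces_of_dense (φ : Fml) {p : ZFSet.{u}} (hp : p ∈ P)
    {v : ℕ → ZFSet.{u}} (hv : ∀ n, v n ∈ N)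
    (h : ∀ q ∈ P, ZFSet.pair q p ∈ le → ∃ r ∈ P, ZFSet.pair r q ∈ le ∧ Forces N P le φ r v) :
    Forces N P le φ p v := by
  induction φ generalizing p v with
  | mem i j => exact hF.forcesMem_of_dense h
  | eq i j => exact hF.forcesEq_of_dense hp (hv i) (hv j) h
  | impl φ ψ ihφ ihψ =>
    intro q hq hle hφ
    refine ihψ hq hv fun q' hq' hle' => ?_
    obtain ⟨r, hr, hl, h'⟩ := h q' hq' (hF.le_trans hle' hle)
    exact ⟨r, hr, hl, h' r hr (hF.le_refl hr)
      (hF.forces_mono φ hq hr hv hφ (hF.le_trans hl hle'))⟩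
  | not φ ih =>
    intro q hq hle hφ
    obtain ⟨r, hr, hl, h'⟩ := h q hq hle
    exact h' r hr (hF.le_refl hr) (hF.forces_mono φ hq hr hv hφ hl)
  | all n φ ih =>
    intro τ hτ
    refine ih hp (update_mem hv n hτ) fun q hq hle => ?_
    obtain ⟨r, hr, hl, h'⟩ := h q hq hle
    exact ⟨r, hr, hl, h' τ hτ⟩

theorem exists_le_forall_not_forces (φ : Fml) {p : ZFSet.{u}} (hp : p ∈ P)
    {v : ℕ → ZFSet.{u}} (hv : ∀ n, v n ∈ N) (h : ¬ Forces N P le φ p v) :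
    ∃ q ∈ P, ZFSet.pair q p ∈ le ∧ ∀ r ∈ P, ZFSet.pair r q ∈ le → ¬ Forces N P le φ r v := by
  contrapose! h
  exact hF.forces_of_dense φ hp hv h

theorem dfb_forces_apply (φ : Fml) {s : (ℕ → ZFSet.{u}) → ZFSet.{u}}
    {t : ℕ → (ℕ → ZFSet.{u}) → ZFSet.{u}} (hs : SimpleTerm N s) (ht : ∀ n, SimpleTerm N (t n)) :
    Dfb N fun w => Forces N P le φ (s w) fun n => t n w := by
  refine ((hF.dfb_forces φ).reindex (t := fun n w => Env.cons (s w) (fun k => t k w) n)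
    fun n => ?_).congr fun v _ => Iff.rfl
  cases n
  exacts [hs, ht _]

theorem dfb_forces_const (φ : Fml) (i : ℕ) {v : ℕ → ZFSet.{u}} (hv : ∀ n, v n ∈ N) :
    Dfb N fun w => Forces N P le φ (w i) v :=
  hF.dfb_forces_apply φ (.var i) fun n => .const (hv n)

theorem dfb_forces_update (φ : Fml) (i m j : ℕ) {v : ℕ → ZFSet.{u}} (hv : ∀ n, v n ∈ N) :
    Dfb N fun w => Forces N P le φ (w i) (Function.update v m (w j)) := by
  refine hF.dfb_forces_apply φ (t := fun n w => Function.update v m (w j) n) (.var i) fun n => ?_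
  by_cases h : n = m
  · subst h; simpa using SimpleTerm.var j
  · simpa [h] using SimpleTerm.const (hv n)

/-! ### The truth lemma -/

variable {G : Set ZFSet.{u}} (hG : ZGeneric N P le G)

include hG

omit hF in
theorem filter_sub {p : ZFSet.{u}} (hp : p ∈ G) : p ∈ P := hG.1.1 p hp

omit hF in
theorem filter_up {p q : ZFSet.{u}} (hp : p ∈ G) (hq : q ∈ P) (h : ZFSet.pair p q ∈ le) :
    q ∈ G := hG.1.2.2.1 p hp q hq h

omit hF in
theorem filter_dir {p q : ZFSet.{u}} (hp : p ∈ G) (hq : q ∈ G) :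
    ∃ r ∈ G, ZFSet.pair r p ∈ le ∧ ZFSet.pair r q ∈ le := hG.1.2.2.2 p hp q hq

theorem exists_mem_of_dense {R : ZFSet.{u} → Prop} (hR : Dfb N fun v => R (v 0))
    (h : ∀ p ∈ P, ∃ q ∈ P, ZFSet.pair q p ∈ le ∧ R q) : ∃ p ∈ G, R p := by
  obtain ⟨p, hp, hpD⟩ := hG.2 _ (hF.basic.sep_mem hR hF.cond_mem)
    ⟨fun z hz => (ZFSet.mem_sep.1 hz).1, fun p hp => by
      obtain ⟨q, hq, hle, h⟩ := h p hp
      exact ⟨q, ZFSet.mem_sep.2 ⟨hq, h⟩, hle⟩⟩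
  exact ⟨p, hp, (ZFSet.mem_sep.1 hpD).2⟩

theorem exists_mem_of_dense_below {R : ZFSet.{u} → Prop} (hR : Dfb N fun v => R (v 0))
    {p : ZFSet.{u}} (hp : p ∈ G)
    (h : ∀ q ∈ P, ZFSet.pair q p ∈ le → ∃ r ∈ P, ZFSet.pair r q ∈ le ∧ R r) : ∃ q ∈ G, R q := by
  have hpN := hF.trans _ hF.cond_mem _ (filter_sub hG hp)
  obtain ⟨q, hq, hRq | hinc⟩ := hF.exists_mem_of_dense hG
    (R := fun q => R q ∨ ¬ ∃ r, r ∈ P ∧ ZFSet.pair r q ∈ le ∧ ZFSet.pair r p ∈ le)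
    (hR.or (Dfb.not (Dfb.bex hF.trans (.const hF.cond_mem)
      ((hF.dfb_le (.var 0) (.var 1)).and (hF.dfb_le (.var 0) (.const hpN)))))) (by
    intro q hq
    by_cases hc : ∃ r, r ∈ P ∧ ZFSet.pair r q ∈ le ∧ ZFSet.pair r p ∈ le
    · obtain ⟨r, hr, hrq, hrp⟩ := hc
      obtain ⟨r', hr', hl, h'⟩ := h r hr hrp
      exact ⟨r', hr', hF.le_trans hl hrq, .inl h'⟩
    · exact ⟨q, hq, hF.le_refl hq, .inr hc⟩)
  · exact ⟨q, hq, hRq⟩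
  · obtain ⟨r, hr, hrq, hrp⟩ := filter_dir hG hq hp
    exact absurd ⟨r, filter_sub hG hr, hrq, hrp⟩ hinc

/-- If `Meets` holds densely below an element of `G`, then it is witnessed in `G`. -/
theorem exists_child_of_meets {E : ZFSet.{u} → ZFSet.{u} → Prop}
    (hE : Dfb N fun v => E (v 0) (v 1)) {p τ : ZFSet.{u}} (hp : p ∈ G) (hτ : τ ∈ N)
    (h : ∀ q ∈ P, ZFSet.pair q p ∈ le → Meets N P le E q τ) :
    ∃ ρ ∈ N, ∃ s ∈ G, Child P ρ s τ ∧ ∃ q ∈ G, E q ρ := by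
  obtain ⟨q, hq, ρ, hρ, s, hs, hc, hle, hE⟩ := hF.exists_mem_of_dense_below hG
    (R := fun q => ∃ ρ, ρ ∈ N ∧ ∃ s, s ∈ P ∧ Child P ρ s τ ∧ ZFSet.pair q s ∈ le ∧ E q ρ)
    (Dfb.ex (Dfb.bex hF.trans (.const hF.cond_mem)
      ((hF.dfb_child (.var 1) (.var 0) (.const hτ)).and ((hF.dfb_le (.var 2) (.var 0)).and
        (hE.app₂ (.var 2) (.var 1)))))) hp h
  exact ⟨ρ, hρ, s, filter_up hG hq hs hle, hc, q, hq, hE⟩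

theorem nameVal_eq_of_forcesEq {p σ τ : ZFSet.{u}} (hp : p ∈ G) (hσ : σ ∈ N) (hτ : τ ∈ N)
    (h : ForcesEq N P le p σ τ) : nameVal P G σ = nameVal P G τ := by
  induction ho : σ.rank using WellFoundedLT.induction generalizing p σ τ with | _ o ih
  subst ho
  obtain ⟨h1, h2⟩ := forcesSub_of_forcesEq (filter_sub hG hp) hσ hτ h
  ext y
  rw [mem_nameVal, mem_nameVal]
  constructor
  · rintro ⟨π, r, hr, hc, rfl⟩
    have hπ := hF.child_mem hc hσ
    obtain ⟨q, hq, hqp, hqr⟩ := filter_dir hG hp hr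
    obtain ⟨ρ, hρ, s, hs, hcs, q', hq', he⟩ := hF.exists_child_of_meets hG
      (E := fun q ρ => ForcesEq N P le q π ρ)
      (hF.dfb_forcesEq (.var 0) (.const hπ) (.var 1)) hq hτ
      fun q' hq' hle => h1 π hπ r hc.1 hc q' hq' (hF.le_trans hle hqp) (hF.le_trans hle hqr)
    exact ⟨ρ, s, hs, hcs, (ih _ hc.rank_lt hq' hπ hρ he rfl).symm⟩
  · rintro ⟨π, r, hr, hc, rfl⟩
    have hπ := hF.child_mem hc hτ
    obtain ⟨q, hq, hqp, hqr⟩ := filter_dir hG hp hr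
    obtain ⟨ρ, hρ, s, hs, hcs, q', hq', he⟩ := hF.exists_child_of_meets hG
      (E := fun q ρ => ForcesEq N P le q ρ π)
      (hF.dfb_forcesEq (.var 0) (.var 1) (.const hπ)) hq hσ
      fun q' hq' hle => h2 π hπ r hc.1 hc q' hq' (hF.le_trans hle hqp) (hF.le_trans hle hqr)
    exact ⟨ρ, s, hs, hcs, ih _ hcs.rank_lt hq' hρ hπ he rfl⟩

theorem exists_forcesEq {σ τ : ZFSet.{u}} (hσ : σ ∈ N) (hτ : τ ∈ N)
    (h : nameVal P G σ = nameVal P G τ) : ∃ p ∈ G, ForcesEq N P le p σ τ := by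
  induction ho : σ.rank using WellFoundedLT.induction generalizing σ τ with | _ o ih
  subst ho
  have hmeets {E : ZFSet.{u} → ZFSet.{u} → ZFSet.{u} → Prop}
      (hE : Dfb N fun v => E (v 0) (v 1) (v 2)) {σ τ : ZFSet.{u}} (hσ : σ ∈ N) (hτ : τ ∈ N) :
      Dfb N fun v => ∃ π, π ∈ N ∧ ∃ r, r ∈ P ∧ Child P π r σ ∧ ZFSet.pair (v 0) r ∈ le ∧
        ¬ Meets N P le (fun q ρ => E q π ρ) (v 0) τ := by
    refine Dfb.ex (Dfb.bex hF.trans (.const hF.cond_mem)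
      ((hF.dfb_child (.var 1) (.var 0) (.const hσ)).and ((hF.dfb_le (.var 2) (.var 0)).and
        (Dfb.not (Dfb.bex hF.trans (.const hF.cond_mem) ((hF.dfb_le (.var 0) (.var 3)).and
        (Dfb.ex (Dfb.bex hF.trans (.const hF.cond_mem)
          ((hF.dfb_child (.var 1) (.var 0) (.const hτ)).and
          ((hF.dfb_le (.var 2) (.var 0)).and ?_))))))))))
    exact hE.app₃ (.var 2) (.var 4) (.var 1)
  obtain ⟨p, hp, hR⟩ := hF.exists_mem_of_dense hG
    (R := fun p => ForcesEq N P le p σ τ ∨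
      (∃ π, π ∈ N ∧ ∃ r, r ∈ P ∧ Child P π r σ ∧ ZFSet.pair p r ∈ le ∧
        ¬ Meets N P le (fun q ρ => ForcesEq N P le q π ρ) p τ) ∨
      (∃ π, π ∈ N ∧ ∃ r, r ∈ P ∧ Child P π r τ ∧ ZFSet.pair p r ∈ le ∧
        ¬ Meets N P le (fun q ρ => ForcesEq N P le q ρ π) p σ))
    ((hF.dfb_forcesEq (.var 0) (.const hσ) (.const hτ)).or
      ((hmeets (E := fun q a b => ForcesEq N P le q a b)
        (hF.dfb_forcesEq (.var 0) (.var 1) (.var 2)) hσ hτ).or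
      (hmeets (E := fun q a b => ForcesEq N P le q b a)
        (hF.dfb_forcesEq (.var 0) (.var 2) (.var 1)) hτ hσ))) (by
    intro p hp
    by_contra! hcon
    refine (hcon p hp (hF.le_refl hp)).1 (hF.forcesEq_of_forcesSub hp hσ hτ ?_ ?_)
    · intro π hπ r hr hc q hq hqp hqr
      exact (hcon q hq hqp).2.1 π hπ r hr hc hqr
    · intro π hπ r hr hc q hq hqp hqr
      exact (hcon q hq hqp).2.2 π hπ r hr hc hqr)
  rcases hR with hR | ⟨π, hπ, r, hr, hc, hle, hn⟩ | ⟨π, hπ, r, hr, hc, hle, hn⟩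
  · exact ⟨p, hp, hR⟩
  · exfalso
    have hmem : nameVal P G π ∈ nameVal P G τ := by
      rw [← h]
      exact mem_nameVal.2 ⟨π, r, filter_up hG hp hr hle, hc, rfl⟩
    obtain ⟨ρ, s, hs, hcs, he⟩ := mem_nameVal.1 hmem
    have hρ := hF.child_mem hcs hτ
    obtain ⟨q, hq, hqe⟩ := ih _ hc.rank_lt hπ hρ he.symm rfl
    obtain ⟨q₁, hq₁, h₁, h₁'⟩ := filter_dir hG hp hq
    obtain ⟨q₂, hq₂, h₂, h₂'⟩ := filter_dir hG hq₁ hs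
    exact hn ⟨q₂, filter_sub hG hq₂, hF.le_trans h₂ h₁, ρ, hρ, s, hcs.1, hcs, h₂',
      hF.forcesEq_mono (filter_sub hG hq) (filter_sub hG hq₂) hπ hρ hqe (hF.le_trans h₂ h₁')⟩
  · exfalso
    have hmem : nameVal P G π ∈ nameVal P G σ := by
      rw [h]
      exact mem_nameVal.2 ⟨π, r, filter_up hG hp hr hle, hc, rfl⟩
    obtain ⟨ρ, s, hs, hcs, he⟩ := mem_nameVal.1 hmem
    have hρ := hF.child_mem hcs hσ
    obtain ⟨q, hq, hqe⟩ := ih _ hcs.rank_lt hρ hπ he rfl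
    obtain ⟨q₁, hq₁, h₁, h₁'⟩ := filter_dir hG hp hq
    obtain ⟨q₂, hq₂, h₂, h₂'⟩ := filter_dir hG hq₁ hs
    exact hn ⟨q₂, filter_sub hG hq₂, hF.le_trans h₂ h₁, ρ, hρ, s, hcs.1, hcs, h₂',
      hF.forcesEq_mono (filter_sub hG hq) (filter_sub hG hq₂) hρ hπ hqe (hF.le_trans h₂ h₁')⟩

theorem nameVal_eq_iff {σ τ : ZFSet.{u}} (hσ : σ ∈ N) (hτ : τ ∈ N) :
    nameVal P G σ = nameVal P G τ ↔ ∃ p ∈ G, ForcesEq N P le p σ τ :=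
  ⟨hF.exists_forcesEq hG hσ hτ, fun ⟨_, hp, h⟩ => hF.nameVal_eq_of_forcesEq hG hp hσ hτ h⟩

theorem nameVal_mem_iff {σ τ : ZFSet.{u}} (hσ : σ ∈ N) (hτ : τ ∈ N) :
    nameVal P G σ ∈ nameVal P G τ ↔ ∃ p ∈ G, ForcesMem N P le p σ τ := by
  constructor
  · intro h
    obtain ⟨ρ, s, hs, hc, he⟩ := mem_nameVal.1 h
    have hρ := hF.child_mem hc hτ
    obtain ⟨q, hq, hqe⟩ := hF.exists_forcesEq hG hσ hρ he.symm
    obtain ⟨p, hp, hpq, hps⟩ := filter_dir hG hq hs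
    exact ⟨p, hp, fun r hr hle => ⟨r, hr, hF.le_refl hr, ρ, hρ, s, hc.1, hc, hF.le_trans hle hps,
      hF.forcesEq_mono (filter_sub hG hq) hr hσ hρ hqe (hF.le_trans hle hpq)⟩⟩
  · rintro ⟨p, hp, h⟩
    obtain ⟨ρ, hρ, s, hs, hc, q, hq, he⟩ := hF.exists_child_of_meets hG
      (E := fun q ρ => ForcesEq N P le q σ ρ)
      (hF.dfb_forcesEq (.var 0) (.const hσ) (.var 1)) hp hτ h
    exact mem_nameVal.2 ⟨ρ, s, hs, hc, (hF.nameVal_eq_of_forcesEq hG hq hσ hρ he).symm⟩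

theorem sat_iff_forces (φ : Fml) {v : ℕ → ZFSet.{u}} (hv : ∀ n, v n ∈ N) :
    FmlSat (NameExt N P G) φ (fun n => nameVal P G (v n)) ↔ ∃ p ∈ G, Forces N P le φ p v := by
  have hP := hF.cond_mem
  induction φ generalizing v with
  | mem i j => exact hF.nameVal_mem_iff hG (hv i) (hv j)
  | eq i j => exact hF.nameVal_eq_iff hG (hv i) (hv j)
  | impl φ ψ ihφ ihψ =>
    simp only [FmlSat, ihφ hv, ihψ hv]
    constructor
    · intro h
      obtain ⟨p, hp, hR | ⟨hφ, hψ⟩⟩ := hF.exists_mem_of_dense hG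
        (R := fun p => Forces N P le (.impl φ ψ) p v ∨ (Forces N P le φ p v ∧
          ∀ q, q ∈ P → ZFSet.pair q p ∈ le → ¬ Forces N P le ψ q v))
        ((hF.dfb_forces_const _ 0 hv).or ((hF.dfb_forces_const _ 0 hv).and
          (Dfb.ball hF.trans (.const hP) (Dfb.imp (hF.dfb_le (.var 0) (.var 1))
            (hF.dfb_forces_const _ 0 hv).not)))) (by
        intro p hp
        by_cases hi : Forces N P le (.impl φ ψ) p v
        · exact ⟨p, hp, hF.le_refl hp, .inl hi⟩
        simp only [Forces, not_forall] at hi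
        obtain ⟨q, hq, hle, hφ, hψ⟩ := hi
        obtain ⟨r, hr, hl, hn⟩ := hF.exists_le_forall_not_forces ψ hq hv hψ
        exact ⟨r, hr, hF.le_trans hl hle, .inr ⟨hF.forces_mono φ hq hr hv hφ hl, hn⟩⟩)
      · exact ⟨p, hp, hR⟩
      · obtain ⟨q, hq, hqψ⟩ := h ⟨p, hp, hφ⟩
        obtain ⟨r, hr, hrp, hrq⟩ := filter_dir hG hp hq
        exact absurd (hF.forces_mono ψ (filter_sub hG hq) (filter_sub hG hr) hv hqψ hrq)
          (hψ r (filter_sub hG hr) hrp)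
    · rintro ⟨p, hp, h⟩ ⟨q, hq, hφ⟩
      obtain ⟨r, hr, hrp, hrq⟩ := filter_dir hG hp hq
      have hr' := filter_sub hG hr
      exact ⟨r, hr, h r hr' hrp (hF.forces_mono φ (filter_sub hG hq) hr' hv hφ hrq)⟩
  | not φ ih =>
    simp only [FmlSat, ih hv]
    constructor
    · intro h
      obtain ⟨p, hp, hR | hR⟩ := hF.exists_mem_of_dense hG
        (R := fun p => Forces N P le φ p v ∨ Forces N P le (.not φ) p v)
        ((hF.dfb_forces_const _ 0 hv).or (hF.dfb_forces_const _ 0 hv)) (by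
        intro p hp
        by_cases hi : Forces N P le (.not φ) p v
        · exact ⟨p, hp, hF.le_refl hp, .inr hi⟩
        simp only [Forces, not_forall, not_not] at hi
        obtain ⟨q, hq, hle, hφ⟩ := hi
        exact ⟨q, hq, hle, .inl hφ⟩)
      · exact absurd ⟨p, hp, hR⟩ h
      · exact ⟨p, hp, hR⟩
    · rintro ⟨p, hp, h⟩ ⟨q, hq, hφ⟩
      obtain ⟨r, hr, hrp, hrq⟩ := filter_dir hG hp hq
      have hr' := filter_sub hG hr
      exact h r hr' hrp (hF.forces_mono φ (filter_sub hG hq) hr' hv hφ hrq)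
  | all m φ ih =>
    have hval (τ : ZFSet.{u}) : Function.update (fun n => nameVal P G (v n)) m (nameVal P G τ) =
        fun n => nameVal P G (Function.update v m τ n) :=
      (Function.comp_update (nameVal P G) v m τ).symm
    have key : FmlSat (NameExt N P G) (.all m φ) (fun n => nameVal P G (v n)) ↔
        ∀ τ ∈ N, ∃ p ∈ G, Forces N P le φ p (Function.update v m τ) := by
      constructor
      · intro h τ hτ
        refine (ih (update_mem hv m hτ)).1 ?_
        rw [← hval]
        exact h _ ⟨τ, hτ, rfl⟩
      · rintro h _ ⟨τ, hτ, rfl⟩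
        rw [hval]
        exact (ih (update_mem hv m hτ)).2 (h τ hτ)
    rw [key]
    constructor
    · intro h
      obtain ⟨p, hp, hR | ⟨τ, hτ, hn⟩⟩ := hF.exists_mem_of_dense hG
        (R := fun p => Forces N P le (.all m φ) p v ∨ ∃ τ, τ ∈ N ∧
          ∀ q, q ∈ P → ZFSet.pair q p ∈ le → ¬ Forces N P le φ q (Function.update v m τ))
        ((hF.dfb_forces_const _ 0 hv).or (Dfb.ex (Dfb.ball hF.trans (.const hP)
          (Dfb.imp (hF.dfb_le (.var 0) (.var 2)) (hF.dfb_forces_update φ 0 m 1 hv).not)))) (by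
        intro p hp
        by_cases hi : Forces N P le (.all m φ) p v
        · exact ⟨p, hp, hF.le_refl hp, .inl hi⟩
        simp only [Forces, not_forall] at hi
        obtain ⟨τ, hτ, hφ⟩ := hi
        obtain ⟨r, hr, hl, hn⟩ := hF.exists_le_forall_not_forces φ hp (update_mem hv m hτ) hφ
        exact ⟨r, hr, hl, .inr ⟨τ, hτ, hn⟩⟩)
      · exact ⟨p, hp, hR⟩
      · obtain ⟨q, hq, hqφ⟩ := h τ hτ
        obtain ⟨r, hr, hrp, hrq⟩ := filter_dir hG hp hq
        have hr' := filter_sub hG hr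
        exact absurd (hF.forces_mono φ (filter_sub hG hq) hr' (update_mem hv m hτ) hqφ hrq)
          (hn r hr' hrp)
    · rintro ⟨p, hp, h⟩ τ hτ
      exact ⟨p, hp, h τ hτ⟩

end ForcingNotion

/-! ### The generic extension as a class of values of names -/

theorem simpleTerm_update_update {N : ZClass.{u}} {v : ℕ → ZFSet.{u}} (hv : ∀ n, v n ∈ N)
    (i j n : ℕ) :
    SimpleTerm N fun w => Function.update (Function.update v 0 (w i)) 1 (w j) n := by
  by_cases h1 : n = 1
  · subst h1; simpa using SimpleTerm.var j
  by_cases h0 : n = 0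
  · subst h0; simpa using SimpleTerm.var i
  · simpa [h0, h1] using SimpleTerm.const (hv n)

theorem mem_nameVal_prod {P s y : ZFSet.{u}} {G : Set ZFSet.{u}} (hG : ∀ p ∈ G, p ∈ P)
    (hne : G.Nonempty) :
    y ∈ nameVal P G (ZFSet.prod s P) ↔ ∃ σ ∈ s, nameVal P G σ = y := by
  have hc (σ p : ZFSet.{u}) : Child P σ p (ZFSet.prod s P) ↔ p ∈ P ∧ σ ∈ s := by
    rw [child_iff_of_forall_pair fun z hz => by
      obtain ⟨a, -, b, -, h⟩ := ZFSet.mem_prod.1 hz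
      exact ⟨a, b, h⟩, ZFSet.pair_mem_prod]
    tauto
  simp only [mem_nameVal, hc]
  constructor
  · rintro ⟨σ, p, -, ⟨-, hσ⟩, h⟩
    exact ⟨σ, hσ, h⟩
  · rintro ⟨σ, hσ, h⟩
    obtain ⟨p, hp⟩ := hne
    exact ⟨σ, p, hp, ⟨hG p hp, hσ⟩, h⟩

/-- A name for the ordered pair of the values of two names. -/
noncomputable def pairName (P σ τ : ZFSet.{u}) : ZFSet.{u} :=
  ZFSet.prod {ZFSet.prod {σ, σ} P, ZFSet.prod {σ, τ} P} P

theorem nameVal_pairName {P : ZFSet.{u}} {G : Set ZFSet.{u}} (hG : ∀ p ∈ G, p ∈ P)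
    (hne : G.Nonempty) (σ τ : ZFSet.{u}) :
    nameVal P G (pairName P σ τ) = ZFSet.pair (nameVal P G σ) (nameVal P G τ) := by
  have h (a b : ZFSet.{u}) :
      nameVal P G (ZFSet.prod {a, b} P) = {nameVal P G a, nameVal P G b} := by
    ext y
    rw [mem_nameVal_prod hG hne]
    simp [eq_comm]
  rw [pairName, h, h, h, ZFSet.pair, ZFSet.pair_eq_singleton]

namespace ForcingNotion

variable {N : ZClass.{u}} {P le : ZFSet.{u}} (hF : ForcingNotion N P le)

include hF

theorem exists_name {A : ZFSet.{u}} (hA : A ∈ N) {R : ZFSet.{u} → ZFSet.{u} → Prop}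
    (hR : Dfb N fun v => R (v 0) (v 1)) :
    ∃ τ ∈ N, τ ⊆ ZFSet.prod A P ∧ ∀ σ p, Child P σ p τ ↔ σ ∈ A ∧ p ∈ P ∧ R σ p := by
  have hB := hF.basic
  refine ⟨_, hB.sep_mem (R := fun z => ∃ σ, σ ∈ A ∧ ∃ p, p ∈ P ∧ z = ZFSet.pair σ p ∧ R σ p)
    (Dfb.bex hF.trans (.const hA) (Dfb.bex hF.trans (.const hF.cond_mem)
      ((Dfb.eq (.var 2) (hB.term_pair (.var 1) (.var 0))).and (hR.app₂ (.var 1) (.var 0)))))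
    (hB.prod_mem hA hF.cond_mem), fun z hz => (ZFSet.mem_sep.1 hz).1, fun σ p => ?_⟩
  rw [child_iff_of_forall_pair fun z hz => by
    obtain ⟨-, a, -, b, -, h, -⟩ := ZFSet.mem_sep.1 hz
    exact ⟨a, b, h⟩, ZFSet.mem_sep, ZFSet.pair_mem_prod]
  constructor
  · rintro ⟨-, -, a, ha, b, hb, h, hR⟩
    obtain ⟨rfl, rfl⟩ := ZFSet.pair_inj.1 h
    exact ⟨ha, hb, hR⟩
  · rintro ⟨hσ, hp, hR⟩
    exact ⟨hp, ⟨hσ, hp⟩, σ, hσ, p, hp, rfl, hR⟩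

/-- A set in `N` containing `τ` and closed under children. -/
theorem exists_children {τ : ZFSet.{u}} (hτ : τ ∈ N) :
    ∃ A ∈ N, τ ∈ A ∧ ∀ ρ ∈ A, ∀ σ p, Child P σ p ρ → σ ∈ A := by
  obtain ⟨A, hA, hm⟩ := exists_level hF.trans hF.zfc τ hτ
  exact ⟨A, hA, (hm _).2 ⟨hτ, le_rfl⟩, fun ρ hρ σ p hc => (hm _).2
    ⟨hF.child_mem hc ((hm _).1 hρ).1, hc.rank_lt.le.trans ((hm _).1 hρ).2⟩⟩

theorem term_prod {a : (ℕ → ZFSet.{u}) → ZFSet.{u}} (ha : DfbTerm N a) :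
    DfbTerm N fun v => ZFSet.prod (a v) P where
  mem v hv := hF.basic.prod_mem (ha.mem v hv) hF.cond_mem
  graph := by
    refine ((Dfb.ball hF.trans (.var 0) (Q := fun z v => ∃ x, x ∈ a (Env.tail v) ∧ ∃ y, y ∈ P ∧
      z = ZFSet.pair x y) ?_).and (Dfb.ball hF.trans ha.tail (Q := fun x v => ∀ y, y ∈ P →
        ZFSet.pair x y ∈ v 0) ?_)).congr fun v _ => ?_
    · exact Dfb.bex hF.trans ha.tail.tail (Dfb.bex hF.trans (.const hF.cond_mem)
        (Dfb.eq (.var 2) (hF.basic.term_pair (.var 1) (.var 0))))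
    · exact Dfb.ball hF.trans (.const hF.cond_mem)
        (Dfb.mem (hF.basic.term_pair (.var 1) (.var 0)) (.var 2))
    · constructor
      · rintro ⟨h1, h2⟩
        ext z
        rw [ZFSet.mem_prod]
        exact ⟨h1 z, fun ⟨x, hx, y, hy, h⟩ => h ▸ h2 x hx y hy⟩
      · intro h
        simp only [h, ZFSet.mem_prod, ZFSet.pair_inj]
        exact ⟨fun z hz => hz, fun x hx y hy => ⟨x, hx, y, hy, rfl, rfl⟩⟩

theorem term_pairName {a b : (ℕ → ZFSet.{u}) → ZFSet.{u}} (ha : DfbTerm N a) (hb : DfbTerm N b) :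
    DfbTerm N fun v => pairName P (a v) (b v) :=
  hF.term_prod (.insert_singleton hF.trans hF.basic.pair_mem
    (hF.term_prod (.insert_singleton hF.trans hF.basic.pair_mem ha ha))
    (hF.term_prod (.insert_singleton hF.trans hF.basic.pair_mem ha hb)))

theorem nameExt_trans (G : Set ZFSet.{u}) : ClassTransitive (NameExt N P G) := by
  rintro _ ⟨τ, hτ, rfl⟩ y hy
  obtain ⟨σ, p, -, hc, rfl⟩ := mem_nameVal.1 hy
  exact ⟨σ, hF.child_mem hc hτ, rfl⟩

variable {G : Set ZFSet.{u}} (hG : ZGeneric N P le G)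

include hG

theorem subset_nameExt : N ⊆ NameExt N P G := fun x hx =>
  ⟨_, hF.basic.kpair_mem hF.zfc.empty_mem hx, nameVal_pair_empty hG.1.1 hG.1.2.1 x⟩

theorem image_mem_nameExt {A : ZFSet.{u}} (hA : A ∈ N) :
    ∃ C ∈ NameExt N P G, ∀ y, y ∈ C ↔ ∃ σ ∈ A, nameVal P G σ = y :=
  ⟨_, ⟨_, hF.basic.prod_mem hA hF.cond_mem, rfl⟩,
    fun _ => mem_nameVal_prod hG.1.1 hG.1.2.1⟩

theorem exists_codes_mem_nameExt : ∃ g ∈ NameExt N P G, Codes g G := by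
  have hP := hF.cond_mem
  have hB := hF.basic
  obtain ⟨A, hA, hPA, hAc⟩ := hF.exists_children (hB.kpair_mem hF.zfc.empty_mem hP)
  obtain ⟨τ, hτ, -, hc⟩ := hF.exists_name hA (R := fun σ p => σ = ZFSet.pair ∅ p)
    (Dfb.eq (.var 0) (hB.term_pair (.const hF.zfc.empty_mem) (.var 1)))
  refine ⟨_, ⟨τ, hτ, rfl⟩, fun p => ?_⟩
  simp only [mem_nameVal, hc]
  constructor
  · rintro ⟨_, q, hq, ⟨-, -, rfl⟩, h⟩
    rw [nameVal_pair_empty hG.1.1 hG.1.2.1] at h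
    exact h ▸ hq
  · intro hp
    have hpP := hG.1.1 p hp
    exact ⟨_, p, hp, ⟨hAc _ hPA _ p (child_pair_empty_iff.2 ⟨hpP, p, hpP, rfl⟩), hpP, rfl⟩,
      nameVal_pair_empty hG.1.1 hG.1.2.1 p⟩

theorem nameExt_pair_mem : ∀ x ∈ NameExt N P G, ∀ y ∈ NameExt N P G,
    ({x, y} : ZFSet) ∈ NameExt N P G := by
  rintro _ ⟨σ, hσ, rfl⟩ _ ⟨τ, hτ, rfl⟩
  obtain ⟨C, hC, h⟩ := hF.image_mem_nameExt hG (hF.basic.pair_mem σ hσ τ hτ)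
  convert hC
  ext y
  rw [h]
  simp [eq_comm]

theorem nameExt_union_mem : ∀ x ∈ NameExt N P G, ZFSet.sUnion x ∈ NameExt N P G := by
  rintro _ ⟨τ, hτ, rfl⟩
  have hP := hF.cond_mem
  obtain ⟨A, hA, hτA, hAc⟩ := hF.exists_children hτ
  obtain ⟨ρ, hρ, -, hc⟩ := hF.exists_name hA (R := fun π p => ∃ σ, σ ∈ A ∧ ∃ r, r ∈ P ∧
      ∃ s, s ∈ P ∧ Child P σ r τ ∧ Child P π s σ ∧ ZFSet.pair p r ∈ le ∧ ZFSet.pair p s ∈ le)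
    (Dfb.bex hF.trans (.const hA) (Dfb.bex hF.trans (.const hP) (Dfb.bex hF.trans (.const hP)
      ((hF.dfb_child (.var 2) (.var 1) (.const hτ)).and
      ((hF.dfb_child (.var 3) (.var 0) (.var 2)).and
      ((hF.dfb_le (.var 4) (.var 1)).and (hF.dfb_le (.var 4) (.var 0))))))))
  refine ⟨ρ, hρ, ?_⟩
  ext y
  rw [ZFSet.mem_sUnion, mem_nameVal]
  constructor
  · rintro ⟨π, p, hp, h, rfl⟩
    obtain ⟨-, -, σ, -, r, hr, s, hs, hσ, hπ, hpr, hps⟩ := (hc _ _).1 h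
    exact ⟨_, mem_nameVal.2 ⟨σ, r, filter_up hG hp hr hpr, hσ, rfl⟩,
      mem_nameVal.2 ⟨π, s, filter_up hG hp hs hps, hπ, rfl⟩⟩
  · rintro ⟨z, hz, hy⟩
    obtain ⟨σ, r, hr, hσ, rfl⟩ := mem_nameVal.1 hz
    obtain ⟨π, s, hs, hπ, rfl⟩ := mem_nameVal.1 hy
    obtain ⟨p, hp, hpr, hps⟩ := filter_dir hG hr hs
    have hσA := hAc _ hτA _ _ hσ
    exact ⟨π, p, hp, (hc _ _).2 ⟨hAc _ hσA _ _ hπ, filter_sub hG hp, σ, hσA, r, hσ.1, s, hπ.1,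
      hσ, hπ, hpr, hps⟩, rfl⟩

theorem nameExt_sep_mem : ∀ (φ : Fml) (v : ℕ → ZFSet.{u}), (∀ n, v n ∈ NameExt N P G) →
    ∀ x ∈ NameExt N P G, ZFSet.sep (fun y => FmlSat (NameExt N P G) φ (Function.update v 0 y)) x ∈
      NameExt N P G := by
  rintro φ v hv _ ⟨τ, hτ, rfl⟩
  choose w hw hwv using hv
  obtain rfl : (fun n => nameVal P G (w n)) = v := funext hwv
  have hval (σ : ZFSet.{u}) : Function.update (fun n => nameVal P G (w n)) 0 (nameVal P G σ) =
      fun n => nameVal P G (Function.update w 0 σ n) :=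
    (Function.comp_update (nameVal P G) w 0 σ).symm
  obtain ⟨A, hA, hτA, hAc⟩ := hF.exists_children hτ
  obtain ⟨ρ, hρ, -, hc⟩ := hF.exists_name hA (R := fun σ p => ∃ r, r ∈ P ∧ Child P σ r τ ∧
      ZFSet.pair p r ∈ le ∧ Forces N P le φ p (Function.update w 0 σ))
    (Dfb.bex hF.trans (.const hF.cond_mem) ((hF.dfb_child (.var 1) (.var 0) (.const hτ)).and
      ((hF.dfb_le (.var 2) (.var 0)).and (hF.dfb_forces_update φ 2 0 1 hw))))
  refine ⟨ρ, hρ, ?_⟩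
  ext y
  rw [ZFSet.mem_sep, mem_nameVal]
  constructor
  · rintro ⟨σ, p, hp, h, rfl⟩
    obtain ⟨-, -, r, hr, hσ, hpr, hφ⟩ := (hc _ _).1 h
    refine ⟨mem_nameVal.2 ⟨σ, r, filter_up hG hp hr hpr, hσ, rfl⟩, ?_⟩
    rw [hval]
    exact (hF.sat_iff_forces hG φ (update_mem hw 0 (hF.child_mem hσ hτ))).2 ⟨p, hp, hφ⟩
  · rintro ⟨hy, hs⟩
    obtain ⟨σ, r, hr, hσ, rfl⟩ := mem_nameVal.1 hy
    rw [hval] at hs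
    have hu := update_mem hw 0 (hF.child_mem hσ hτ)
    obtain ⟨q, hq, hφ⟩ := (hF.sat_iff_forces hG φ hu).1 hs
    obtain ⟨p, hp, hpr, hpq⟩ := filter_dir hG hr hq
    exact ⟨σ, p, hp, (hc _ _).2 ⟨hAc _ hτA _ _ hσ, filter_sub hG hp, r, hσ.1, hσ, hpr,
      hF.forces_mono φ (filter_sub hG hq) (filter_sub hG hp) hu hφ hpq⟩, rfl⟩

theorem nameExt_power_mem : ∀ x ∈ NameExt N P G,
    ZFSet.sep (fun y => y ∈ NameExt N P G) (ZFSet.powerset x) ∈ NameExt N P G := by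
  intro x hx
  have hT := hF.nameExt_trans G
  obtain ⟨τ, hτ, hτx⟩ := id hx
  obtain ⟨A, hA, hτA, hAc⟩ := hF.exists_children hτ
  obtain ⟨C, hC, hCm⟩ := hF.image_mem_nameExt hG
    (hF.basic.power_mem _ (hF.basic.prod_mem hA hF.cond_mem))
  convert sep_mem_of_dfb hT (hF.nameExt_sep_mem hG) (R := fun y => ∀ z, z ∈ y → z ∈ x)
    (Dfb.ball hT (.var 0) (Dfb.mem (.var 0) (.const hx))) hC using 1
  ext y
  simp only [ZFSet.mem_sep, ZFSet.mem_powerset]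
  refine ⟨fun ⟨hyx, hy⟩ => ⟨?_, fun z hz => hyx hz⟩, fun ⟨hy, hyx⟩ => ⟨hyx, hT _ hC _ hy⟩⟩
  obtain ⟨π, hπ, rfl⟩ := hy
  obtain ⟨ρ, hρ, hsub, hc⟩ := hF.exists_name hA (R := fun σ p => ForcesMem N P le p σ π)
    (hF.dfb_forcesMem (.var 1) (.var 0) (.const hπ))
  refine (hCm _).2 ⟨ρ, ZFSet.mem_sep.2 ⟨ZFSet.mem_powerset.2 hsub, hρ⟩, ?_⟩
  ext y
  rw [mem_nameVal]
  constructor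
  · rintro ⟨σ, p, hp, h, rfl⟩
    obtain ⟨hσA, -, h⟩ := (hc _ _).1 h
    exact (hF.nameVal_mem_iff hG (hF.trans _ hA _ hσA) hπ).2 ⟨p, hp, h⟩
  · intro hy
    have hyx' := hyx hy
    rw [← hτx] at hyx'
    obtain ⟨σ, r, hr, hσ, rfl⟩ := mem_nameVal.1 hyx'
    have hσA := hAc _ hτA _ _ hσ
    obtain ⟨p, hp, h⟩ := (hF.nameVal_mem_iff hG (hF.trans _ hA _ hσA) hπ).1 hy
    exact ⟨σ, p, hp, (hc _ _).2 ⟨hσA, filter_sub hG hp, h⟩, rfl⟩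

theorem nameExt_basic : BasicModel (NameExt N P G) where
  trans := hF.nameExt_trans G
  pair_mem := hF.nameExt_pair_mem hG
  union_mem := hF.nameExt_union_mem hG
  power_mem := hF.nameExt_power_mem hG
  sep_mem hR _ hx := sep_mem_of_dfb (hF.nameExt_trans G) (hF.nameExt_sep_mem hG) hR hx

theorem nameExt_repl_mem : ∀ (φ : Fml) (v : ℕ → ZFSet.{u}), (∀ n, v n ∈ NameExt N P G) →
    ∀ x ∈ NameExt N P G, ∃ z ∈ NameExt N P G, ∀ b : ZFSet, b ∈ z ↔
      (b ∈ NameExt N P G ∧ ∃ a : ZFSet, a ∈ x ∧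
        FmlSat (NameExt N P G) φ (Function.update (Function.update v 0 a) 1 b) ∧
        ∀ b' ∈ NameExt N P G,
          FmlSat (NameExt N P G) φ (Function.update (Function.update v 0 a) 1 b') → b' = b) := by
  intro φ v hv x hx
  have hB' := hF.nameExt_basic hG
  have hB := hF.basic
  obtain ⟨τ, hτ, hτx⟩ := id hx
  choose w hw hwv using id hv
  have hval (σ π : ZFSet.{u}) :
      Function.update (Function.update v 0 (nameVal P G σ)) 1 (nameVal P G π) =
        fun n => nameVal P G (Function.update (Function.update w 0 σ) 1 π n) := by
    rw [← funext hwv]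
    exact (((Function.comp_update (nameVal P G) _ 1 π).trans
      (congrArg (fun f => Function.update f 1 (nameVal P G π))
        (Function.comp_update (nameVal P G) w 0 σ)))).symm
  obtain ⟨A, hA, hτA, hAc⟩ := hF.exists_children hτ
  obtain ⟨c, hc, hcoll⟩ := exists_collection hF.trans hF.zfc
    (R := fun z π => ∃ σ, σ ∈ A ∧ ∃ p, p ∈ P ∧ z = ZFSet.pair σ p ∧
      Forces N P le φ p (Function.update (Function.update w 0 σ) 1 π))
    (Dfb.bex hF.trans (.const hA) (Dfb.bex hF.trans (.const hF.cond_mem)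
      ((Dfb.eq (.var 2) (hB.term_pair (.var 1) (.var 0))).and
        (hF.dfb_forces_apply φ (.var 0) (simpleTerm_update_update hw 1 3)))))
    (hB.prod_mem hA hF.cond_mem)
  obtain ⟨C, hC, hCm⟩ := hF.image_mem_nameExt hG hc
  refine ⟨_, hB'.sep_mem (R := fun b => ∃ a, a ∈ x ∧
      FmlSat (NameExt N P G) φ (Function.update (Function.update v 0 a) 1 b) ∧
      ∀ b', b' ∈ NameExt N P G →
        FmlSat (NameExt N P G) φ (Function.update (Function.update v 0 a) 1 b') → b' = b)
    (Dfb.bex hB'.trans (.const hx)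
      (((Dfb.sat φ).reindex (simpleTerm_update_update hv 0 1)).and
        (Dfb.all (((Dfb.sat φ).reindex (simpleTerm_update_update hv 1 0)).imp
          (Dfb.eq (.var 0) (.var 2)))))) hC, fun b => ?_⟩
  rw [ZFSet.mem_sep]
  refine and_congr_left fun ⟨a, ha, hs, hu⟩ => ⟨fun hb => hB'.trans _ hC _ hb, fun hb => ?_⟩
  obtain ⟨π, hπ, rfl⟩ := hb
  rw [← hτx] at ha
  obtain ⟨σ, r, hr, hσ, rfl⟩ := mem_nameVal.1 ha
  have hσN := hF.child_mem hσ hτ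
  have hσA := hAc _ hτA _ _ hσ
  rw [hval] at hs
  obtain ⟨p, hp, hφ⟩ := (hF.sat_iff_forces hG φ (update_mem (update_mem hw 0 hσN) 1 hπ)).1 hs
  have hpP := filter_sub hG hp
  obtain ⟨π', hπ', σ', hσ', p', hp', he, hφ'⟩ := hcoll (ZFSet.pair σ p)
    (ZFSet.pair_mem_prod.2 ⟨hσA, hpP⟩) π hπ ⟨σ, hσA, p, hpP, rfl, hφ⟩
  obtain ⟨rfl, rfl⟩ := ZFSet.pair_inj.1 he
  have hπN := hF.trans _ hc _ hπ'
  refine (hCm _).2 ⟨π', hπ', hu _ ⟨π', hπN, rfl⟩ ?_⟩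
  rw [hval]
  exact (hF.sat_iff_forces hG φ (update_mem (update_mem hw 0 hσN) 1 hπN)).2 ⟨p, hp, hφ'⟩

theorem nameVal_graph_mem_nameExt {A : ZFSet.{u}} (hA : A ∈ N) :
    ∃ F ∈ NameExt N P G, ∀ σ b, ZFSet.pair σ b ∈ F ↔ σ ∈ A ∧ nameVal P G σ = b := by
  have hB := hF.basic
  have hT : DfbTerm N fun v => pairName P (ZFSet.pair ∅ (v 0)) (v 0) :=
    hF.term_pairName (hB.term_pair (.const hF.zfc.empty_mem) (.var 0)) (.var 0)
  obtain ⟨B, hBN, hBm⟩ := repl_mem_of_dfb hF.trans hF.zfc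
    (R := fun σ z => z = pairName P (ZFSet.pair ∅ σ) σ)
    (Dfb.eq (.var 1) hT) hA (by rintro a - b - b' - rfl rfl; rfl)
  obtain ⟨F, hFN, hFm⟩ := hF.image_mem_nameExt hG hBN
  refine ⟨F, hFN, fun σ b => ?_⟩
  rw [hFm]
  constructor
  · rintro ⟨z, hz, h⟩
    obtain ⟨-, a, ha, rfl⟩ := (hBm _).1 hz
    rw [nameVal_pairName hG.1.1 hG.1.2.1, nameVal_pair_empty hG.1.1 hG.1.2.1] at h
    obtain ⟨rfl, rfl⟩ := ZFSet.pair_inj.1 h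
    exact ⟨ha, rfl⟩
  · rintro ⟨hσ, rfl⟩
    refine ⟨_, (hBm _).2 ⟨?_, σ, hσ, rfl⟩, ?_⟩
    · exact hT.mem (fun _ => σ) fun _ => hF.trans _ hA _ hσ
    · rw [nameVal_pairName hG.1.1 hG.1.2.1, nameVal_pair_empty hG.1.1 hG.1.2.1]

theorem nameExt_choice_wo : ∀ x ∈ NameExt N P G, ∃ r ∈ NameExt N P G, WellOrders r x := by
  intro x hx
  have hB' := hF.nameExt_basic hG
  have hT := hB'.trans
  obtain ⟨τ, hτ, hτx⟩ := id hx
  obtain ⟨A, hA, hτA, hAc⟩ := hF.exists_children hτ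
  obtain ⟨r, hr, -, hwf⟩ := hF.zfc.choice_wo A hA
  obtain ⟨F, hFN, hFm⟩ := hF.nameVal_graph_mem_nameExt hG hA
  have hA' := hF.subset_nameExt hG hA
  have hr' := hF.subset_nameExt hG hr
  refine ⟨_, hB'.sep_mem (R := fun z => ∃ b, b ∈ x ∧ ∃ b', b' ∈ x ∧ z = ZFSet.pair b b' ∧
      ∃ σ, σ ∈ A ∧ ZFSet.pair σ b ∈ F ∧ ∀ σ', σ' ∈ A → ZFSet.pair σ' b' ∈ F →
        σ = σ' ∨ ZFSet.pair σ σ' ∈ r)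
    (Dfb.bex hT (.const hx) (Dfb.bex hT (.const hx)
      ((Dfb.eq (.var 2) (hB'.term_pair (.var 1) (.var 0))).and
      (Dfb.bex hT (.const hA') ((Dfb.mem (hB'.term_pair (.var 0) (.var 2)) (.const hFN)).and
        (Dfb.ball hT (.const hA') ((Dfb.mem (hB'.term_pair (.var 0) (.var 2)) (.const hFN)).imp
        ((Dfb.eq (.var 1) (.var 0)).or
          (Dfb.mem (hB'.term_pair (.var 1) (.var 0)) (.const hr'))))))))))
    (hB'.prod_mem hx hx), ?_⟩
  set W := ZFSet.sep _ (ZFSet.prod x x) with hW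
  have hleast : ∀ y : ZFSet.{u}, y ⊆ x → y ≠ ∅ →
      ∃ a, a ∈ y ∧ ∀ b ∈ y, a = b ∨ ZFSet.pair a b ∈ W := by
    intro y hyx hne
    obtain ⟨b, hb⟩ := (ZFSet.eq_empty_or_nonempty y).resolve_left hne
    have hb' := hyx hb
    rw [← hτx] at hb'
    obtain ⟨σ, p, -, hσ, rfl⟩ := mem_nameVal.1 hb'
    obtain ⟨σ₀, hσ₀, hmin⟩ := hwf (ZFSet.sep (fun σ => nameVal P G σ ∈ y) A)
      (fun z hz => (ZFSet.mem_sep.1 hz).1) (fun h0 => by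
        have : σ ∈ (∅ : ZFSet.{u}) := h0 ▸ ZFSet.mem_sep.2 ⟨hAc _ hτA _ _ hσ, hb⟩
        simp at this)
    obtain ⟨hσA, hσy⟩ := ZFSet.mem_sep.1 hσ₀
    refine ⟨_, hσy, fun b hb => .inr ?_⟩
    rw [hW, ZFSet.mem_sep, ZFSet.pair_mem_prod]
    refine ⟨⟨hyx hσy, hyx hb⟩, _, hyx hσy, b, hyx hb, rfl, σ₀, hσA, (hFm _ _).2 ⟨hσA, rfl⟩,
      fun σ' hσ' h => hmin σ' (ZFSet.mem_sep.2 ⟨hσ', ?_⟩)⟩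
    rw [((hFm _ _).1 h).2]
    exact hb
  refine ⟨fun a ha b hb => ?_, hleast⟩
  obtain ⟨c, hc, h⟩ := hleast {a, b} (fun z hz => by
    rcases ZFSet.mem_pair.1 hz with rfl | rfl <;> assumption) (fun h0 => by
      have : a ∈ (∅ : ZFSet.{u}) := h0 ▸ ZFSet.mem_pair.2 (.inl rfl)
      simp at this)
  rcases ZFSet.mem_pair.1 hc with rfl | rfl
  · exact (h b (ZFSet.mem_pair.2 (.inr rfl))).imp id .inl
  · exact (h a (ZFSet.mem_pair.2 (.inl rfl))).imp Eq.symm .inr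

theorem nameExt_modelsZFC : ModelsZFC (NameExt N P G) where
  empty_mem := hF.subset_nameExt hG hF.zfc.empty_mem
  omega_mem := hF.subset_nameExt hG hF.zfc.omega_mem
  pair_mem := hF.nameExt_pair_mem hG
  union_mem := hF.nameExt_union_mem hG
  power_mem := hF.nameExt_power_mem hG
  sep_mem := hF.nameExt_sep_mem hG
  repl_mem := hF.nameExt_repl_mem hG
  choice_wo := hF.nameExt_choice_wo hG

end ForcingNotion

theorem ForcingNotion.mem_of_mem_nameExt {N₁ N₂ : ZClass.{u}} {P le : ZFSet.{u}}
    {G : Set ZFSet.{u}} (hF₁ : ForcingNotion N₁ P le) (hF₂ : ForcingNotion N₂ P le)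
    (hsub : N₁ ⊆ N₂) (hG₁ : ZGeneric N₁ P le G) (hG₂ : ZGeneric N₂ P le G) {x : ZFSet.{u}}
    (hx : x ∈ N₂) (hxsub : ∀ y ∈ x, y ∈ N₁) (hxG : x ∈ NameExt N₁ P G) : x ∈ N₁ := by
  have hB₁ := hF₁.basic
  have hB₂ := hF₂.basic
  have hval (y : ZFSet.{u}) : nameVal P G (ZFSet.pair ∅ y) = y :=
    nameVal_pair_empty hG₁.1.1 hG₁.1.2.1 y
  have hcheck {y : ZFSet.{u}} (hy : y ∈ N₁) : ZFSet.pair ∅ y ∈ N₁ :=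
    hB₁.kpair_mem hF₁.zfc.empty_mem hy
  obtain ⟨τ, hτ, rfl⟩ := hxG
  set x := nameVal P G τ with hxτ
  obtain ⟨A, hA, hAm⟩ := exists_level hF₁.trans hF₁.zfc τ hτ
  have hxA : ∀ y ∈ x, y ∈ A := fun y hy => (hAm y).2 ⟨hxsub y hy,
    (ZFSet.rank_lt_of_mem hy).le.trans (rank_nameVal_le P G τ)⟩
  obtain ⟨S, hS, -, hSm⟩ := hF₁.exists_name hA
    (R := fun y p => ForcesMem N₁ P le p (ZFSet.pair ∅ y) τ)
    (hF₁.dfb_forcesMem (.var 1) (hB₁.term_pair (.const hF₁.zfc.empty_mem) (.var 0)) (.const hτ))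
  have hforced {y : ZFSet.{u}} (hy : y ∈ A) :
      y ∈ x ↔ ∃ p ∈ G, ForcesMem N₁ P le p (ZFSet.pair ∅ y) τ := by
    rw [← hF₁.nameVal_mem_iff hG₁ (hcheck (hF₁.trans _ hA _ hy)) hτ, hval]
  let D : ZFSet.{u} → Prop := fun p => ∃ y, y ∈ A ∧
    ((y ∈ x ∧ ∀ q, q ∈ P → ZFSet.pair q p ∈ le → ¬ Child P y q S) ∨ (¬ y ∈ x ∧ Child P y p S))
  have hD {t} (ht : DfbTerm N₂ t) : Dfb N₂ fun v => D (t v) := by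
    refine Dfb.app₁ (R := D) ?_ ht
    exact Dfb.bex hF₂.trans (.const (hsub hA)) (((Dfb.mem (.var 0) (.const hx)).and
      (Dfb.ball hF₂.trans (.const hF₂.cond_mem) ((hF₂.dfb_le (.var 0) (.var 2)).imp
        (hF₂.dfb_child (.var 1) (.var 0) (.const (hsub hS))).not))).or
      ((Dfb.mem (.var 0) (.const hx)).not.and
        (hF₂.dfb_child (.var 0) (.var 1) (.const (hsub hS)))))
  obtain ⟨p, hp, h | h⟩ := hF₂.exists_mem_of_dense hG₂
    (R := fun p => D p ∨ ¬ ∃ q, q ∈ P ∧ ZFSet.pair q p ∈ le ∧ D q)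
    ((hD (.var 0)).or (Dfb.not (Dfb.bex hF₂.trans (.const hF₂.cond_mem)
      ((hF₂.dfb_le (.var 0) (.var 1)).and (hD (.var 0)))))) (by
    intro p hp
    by_cases h : ∃ q, q ∈ P ∧ ZFSet.pair q p ∈ le ∧ D q
    · obtain ⟨q, hq, hle, h⟩ := h
      exact ⟨q, hq, hle, .inl h⟩
    · exact ⟨p, hp, hF₁.le_refl hp, .inr h⟩)
  · exfalso
    obtain ⟨y, hyA, ⟨hyx, hn⟩ | ⟨hyx, hc⟩⟩ := h
    · obtain ⟨q, hq, hqf⟩ := (hforced hyA).1 hyx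
      obtain ⟨r, hr, hrp, hrq⟩ := filter_dir hG₁ hp hq
      have hrP := filter_sub hG₁ hr
      exact hn r hrP hrp ((hSm _ _).2 ⟨hyA, hrP, hF₁.forcesMem_mono hqf hrq⟩)
    · exact hyx ((hforced hyA).2 ⟨p, hp, ((hSm _ _).1 hc).2.2⟩)
  · have hpP := filter_sub hG₁ hp
    convert hB₁.sep_mem (R := fun y => ForcesMem N₁ P le p (ZFSet.pair ∅ y) τ)
      (hF₁.dfb_forcesMem (.const (hF₁.trans _ hF₁.cond_mem _ hpP))
        (hB₁.term_pair (.const hF₁.zfc.empty_mem) (.var 0)) (.const hτ)) hA using 1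
    ext y
    rw [ZFSet.mem_sep]
    constructor
    · intro hy
      have hyA := hxA y hy
      refine ⟨hyA, hF₁.forcesMem_of_dense fun q hq hle => ?_⟩
      by_contra! hcon
      exact h ⟨q, hq, hle, y, hyA, .inl ⟨hy, fun r hr hl hc =>
        hcon r hr hl ((hSm _ _).1 hc).2.2⟩⟩
    · rintro ⟨hyA, hy⟩
      by_contra hyx
      exact h ⟨p, hpP, hF₁.le_refl hpP, y, hyA, .inr ⟨hyx, (hSm _ _).2 ⟨hyA, hpP, hy⟩⟩⟩

/-- If `N₁ ⊆ N₂` are transitive models of ZFC with the same ordinals, `ℙ ∈ N₁` is a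
forcing notion, and `G` is a filter on `ℙ` that is both `(N₁,ℙ)`-generic and
`(N₂,ℙ)`-generic with `N₁[G] = N₂[G]`, then `N₁ = N₂`. -/
theorem grounds_with_common_generic_coincide
    (N₁ N₂ : ZClass)
    (h₁t : ClassTransitive N₁) (h₂t : ClassTransitive N₂)
    (h₁z : ModelsZFC N₁) (h₂z : ModelsZFC N₂)
    (hsub : N₁ ⊆ N₂)
    (hords : ∀ x : ZFSet, ZOrd x → (x ∈ N₁ ↔ x ∈ N₂))
    (P le : ZFSet) (hP : P ∈ N₁) (hle : le ∈ N₁) (hpos : ZPoset P le)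
    (G : Set ZFSet)
    (hG₁ : ZGeneric N₁ P le G) (hG₂ : ZGeneric N₂ P le G)
    (NG : ZClass)
    (hext₁ : IsGenericExt N₁ G NG) (hext₂ : IsGenericExt N₂ G NG) :
    N₁ = N₂ := by
  have hF₁ : ForcingNotion N₁ P le := ⟨h₁t, h₁z, hP, hle, hpos⟩
  have hF₂ : ForcingNotion N₂ P le := ⟨h₂t, h₂z, hsub hP, hsub hle, hpos⟩
  have hNG : NG ⊆ NameExt N₁ P G := hext₁.2.2.2.2 _ (hF₁.nameExt_trans G)
    (hF₁.nameExt_modelsZFC hG₁) (hF₁.subset_nameExt hG₁) (hF₁.exists_codes_mem_nameExt hG₁)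
  refine Set.Subset.antisymm hsub fun x hx => ?_
  induction x using ZFSet.inductionOn with | _ x ih
  exact hF₁.mem_of_mem_nameExt hF₂ hsub hG₁ hG₂ hx (fun y hy => ih y hy (h₂t _ hx _ hy))
    (hNG (hext₂.2.2.1 hx))
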